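/- arXiv:2108.11132 — 2 statements merged into one kernel-verified Lean document; each statement's English description precedes it below -/
import Mathlib

section
/- Let U ⊂ ℤ^d be a finite set of integer vectors and c ∈ ℚ^d a rational vector. Then for every positive integer t, #(t(c + Z(U)) ∩ ℤ^d) = Σ_W χ_W(t) · relvol(Z(W)) · t^{|W|}, where the sum runs over all linearly independent subsets W ⊆ U, and χ_W(t) = 1 if (tc + span_ℝ(W)) ∩ ℤ^d ≠ ∅ and χ_W(t) = 0 otherwise. -/
open Pointwise MeasureTheory
open scoped RealInnerProductSpace

noncomputable section

/-- Cast an integer vector to a real vector. -/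
def castVec {d : ℕ} (x : Fin d → ℤ) : Fin d → ℝ := fun i => (x i : ℝ)

/-- Cast a rational vector to a real vector. -/
def ratVec {d : ℕ} (c : Fin d → ℚ) : Fin d → ℝ := fun i => (c i : ℝ)

/-- `den(c)`: the lcm of the denominators of the coordinates of a rational vector. -/
def denv {d : ℕ} (c : Fin d → ℚ) : ℕ := Finset.univ.lcm fun i => (c i).den

/-- The number of lattice points in a subset of `ℝ^d`. -/
def latCount {d : ℕ} (S : Set (Fin d → ℝ)) : ℕ := {x : Fin d → ℤ | castVec x ∈ S}.ncard

/-- A lattice polytope: the convex hull of a nonempty finite set of integer points. -/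
def IsLatticePolytope {d : ℕ} (P : Set (Fin d → ℝ)) : Prop :=
  ∃ V : Finset (Fin d → ℤ), V.Nonempty ∧ P = convexHull ℝ (castVec '' (V : Set (Fin d → ℤ)))

/-- The zonotope spanned by a finite set of integer vectors. -/
def zonotopeF {d : ℕ} (U : Finset (Fin d → ℤ)) : Set (Fin d → ℝ) :=
  {x | ∃ lam : (Fin d → ℤ) → ℝ, (∀ u, lam u ∈ Set.Icc (0 : ℝ) 1) ∧
    x = ∑ u ∈ U, lam u • castVec u}

/-- The zonotope spanned by integer vectors `u 0, …, u (n-1)`. -/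
def zonotopeZ {d n : ℕ} (u : Fin n → Fin d → ℤ) : Set (Fin d → ℝ) :=
  {x | ∃ lam : Fin n → ℝ, (∀ i, lam i ∈ Set.Icc (0 : ℝ) 1) ∧ x = ∑ i, lam i • castVec (u i)}

/-- The zonotope spanned by real vectors `u 0, …, u (n-1)`. -/
def zonotopeR {d n : ℕ} (u : Fin n → Fin d → ℝ) : Set (Fin d → ℝ) :=
  {x | ∃ lam : Fin n → ℝ, (∀ i, lam i ∈ Set.Icc (0 : ℝ) 1) ∧ x = ∑ i, lam i • u i}

/-- A zonotope: a translate of the Minkowski sum of finitely many segments `[0, uᵢ]`. -/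
def IsZonotope {d : ℕ} (P : Set (Fin d → ℝ)) : Prop :=
  ∃ (n : ℕ) (u : Fin n → Fin d → ℝ) (v : Fin d → ℝ), P = v +ᵥ zonotopeR u

/-- A set is centrally symmetric if it is a translate of its negation. -/
def CentrallySymmetric {d : ℕ} (P : Set (Fin d → ℝ)) : Prop :=
  ∃ v : Fin d → ℝ, P = v +ᵥ (-P)

/-- `f` is a family of constituents of `L` with respect to the period `ρ`. -/
def IsConstituents (L : ℕ → ℚ) (ρ : ℕ) (f : ℕ → Polynomial ℚ) : Prop :=
  ∀ t : ℕ, 0 < t → L t = (f (t % ρ)).eval (t : ℚ)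

/-- `ρ` is a period of the quasi-polynomial `L`. -/
def IsPeriodOf (ρ : ℕ) (L : ℕ → ℚ) : Prop := 0 < ρ ∧ ∃ f, IsConstituents L ρ f

/-- `ρ₀` is the minimal period of the quasi-polynomial `L`. -/
def IsMinimalPeriodOf (ρ₀ : ℕ) (L : ℕ → ℚ) : Prop :=
  IsPeriodOf ρ₀ L ∧ ∀ ρ : ℕ, IsPeriodOf ρ L → ρ₀ ≤ ρ

/-- GCD-property with respect to the period `ρ`: constituents with equal
`gcd(ρ, ·)` coincide. -/
def GCDProperty (L : ℕ → ℚ) (ρ : ℕ) : Prop :=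
  ∀ f : ℕ → Polynomial ℚ, IsConstituents L ρ f →
    ∀ k ℓ : ℕ, Nat.gcd ρ k = Nat.gcd ρ ℓ → f (k % ρ) = f (ℓ % ρ)

/-- Symmetry with respect to the period `ρ`: `f_k = f_{ρ-k}` for `0 ≤ k ≤ ρ`. -/
def SymmetricQP (L : ℕ → ℚ) (ρ : ℕ) : Prop :=
  ∀ f : ℕ → Polynomial ℚ, IsConstituents L ρ f →
    ∀ k : ℕ, k ≤ ρ → f (k % ρ) = f ((ρ - k) % ρ)

/-- The Ehrhart counting function `t ↦ #(t(c + P) ∩ ℤ^d)` of the translate `c + P`. -/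
def ehr {d : ℕ} (P : Set (Fin d → ℝ)) (c : Fin d → ℚ) : ℕ → ℚ :=
  fun t => (latCount ((t : ℝ) • (ratVec c +ᵥ P)) : ℚ)

/-- The dimension of a polytope: the dimension of the direction of its affine hull. -/
def polyDim {d : ℕ} (P : Set (Fin d → ℝ)) : ℕ := Module.finrank ℝ (affineSpan ℝ P).direction

/-- `r` is the relative volume of `P` (of dimension `m`): with respect to any lattice
point `v₀` of `P` and any `ℤ`-basis `b` of the lattice `aff₀(P) ∩ ℤ^d`, `r` is the
Lebesgue measure of `P` in the coordinates determined by `v₀` and `b`. -/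
def IsRelVolOf {d : ℕ} (P : Set (Fin d → ℝ)) (m : ℕ) (r : ℝ) : Prop :=
  ∀ (v₀ : Fin d → ℤ) (b : Fin m → Fin d → ℤ),
    castVec v₀ ∈ P → LinearIndependent ℤ b →
    (∀ x : Fin d → ℤ,
      castVec x ∈ (affineSpan ℝ P).direction ↔ x ∈ Submodule.span ℤ (Set.range b)) →
    r = (volume {lam : Fin m → ℝ | castVec v₀ + ∑ i, lam i • castVec (b i) ∈ P}).toReal

/-- The (real casts of the) elements of `W` are linearly independent over `ℝ`. -/
def LinIndepF {d : ℕ} (W : Finset (Fin d → ℤ)) : Prop :=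
  LinearIndependent ℝ fun w : ↥W => castVec w.1

/-- Almost locally constant: locally constant outside a discrete point set. -/
def AlmostLocallyConstant (f : ℝ → ℝ) : Prop :=
  ∃ D : Set ℝ, DiscreteTopology D ∧ IsLocallyConstant fun x : ↥(Dᶜ) => f ↑x

/-- Almost constant: constant outside a discrete point set. -/
def AlmostConstant (f : ℝ → ℝ) : Prop :=
  ∃ D : Set ℝ, DiscreteTopology D ∧ ∃ r : ℝ, ∀ x ∉ D, f x = r

/-- The face of `P` in the outer normal direction `v`. -/
def normalFace {d : ℕ} (P : Set (EuclideanSpace ℝ (Fin d)))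
    (v : EuclideanSpace ℝ (Fin d)) : Set (EuclideanSpace ℝ (Fin d)) :=
  {x | x ∈ P ∧ ∀ y ∈ P, ⟪y, v⟫ ≤ ⟪x, v⟫}

/-- `F` is a facet of the `d`-polytope `P`: an exposed face of dimension `d - 1`. -/
def IsFacetOf {d : ℕ} (F P : Set (EuclideanSpace ℝ (Fin d))) : Prop :=
  (∃ v : EuclideanSpace ℝ (Fin d), v ≠ 0 ∧ F = normalFace P v) ∧
  Module.finrank ℝ (affineSpan ℝ F).direction = d - 1
open scoped Classical

/-- The set of sums `∑ i ∈ s, lam i • v i` whose coefficients all lie in `I`. -/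
def boxSum {ι V : Type*} [AddCommGroup V] [Module ℝ V] (I : Set ℝ) (v : ι → V)
    (s : Finset ι) : Set V :=
  {x | ∃ lam : ι → ℝ, (∀ i, lam i ∈ I) ∧ x = ∑ i ∈ s, lam i • v i}

section BoxSum

variable {ι V V' : Type*} [AddCommGroup V] [Module ℝ V] [AddCommGroup V'] [Module ℝ V']

theorem boxSum_mono {I J : Set ℝ} (h : I ⊆ J) (v : ι → V) (s : Finset ι) :
    boxSum I v s ⊆ boxSum J v s :=
  fun _ ⟨lam, hlam, hx⟩ => ⟨lam, fun i => h (hlam i), hx⟩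

theorem mem_boxSum_insert {I : Set ℝ} {v : ι → V} {s : Finset ι} {a : ι} (ha : a ∉ s) {x : V} :
    x ∈ boxSum I v (insert a s) ↔ ∃ r ∈ I, x - r • v a ∈ boxSum I v s := by
  constructor
  · rintro ⟨lam, hlam, rfl⟩
    exact ⟨lam a, hlam a, lam, hlam, by rw [Finset.sum_insert ha]; abel⟩
  · rintro ⟨r, hr, lam, hlam, h⟩
    refine ⟨Function.update lam a r, fun i => ?_, ?_⟩
    · by_cases hi : i = a
      · subst hi; simpa
      · simpa [hi] using hlam i
    · rw [Finset.sum_insert ha, Function.update_self, sub_eq_iff_eq_add'.1 h]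
      congr 1
      refine Finset.sum_congr rfl fun i hi => ?_
      rw [Function.update_of_ne (ne_of_mem_of_not_mem hi ha)]

theorem mem_boxSum_map {I : Set ℝ} {v : ι → V} {s : Finset ι} (f : V →ₗ[ℝ] V') {y : V'} :
    y ∈ boxSum I (f ∘ v) s ↔ ∃ x ∈ boxSum I v s, f x = y := by
  constructor
  · rintro ⟨lam, hlam, rfl⟩
    exact ⟨_, ⟨lam, hlam, rfl⟩, by simp⟩
  · rintro ⟨_, ⟨lam, hlam, rfl⟩, rfl⟩
    exact ⟨lam, hlam, by simp⟩

theorem boxSum_subset_span (I : Set ℝ) (v : ι → V) (s : Finset ι) :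
    boxSum I v s ⊆ Submodule.span ℝ (v '' (s : Set ι)) := by
  rintro _ ⟨lam, -, rfl⟩
  exact Submodule.sum_mem _ fun i hi => Submodule.smul_mem _ _
    (Submodule.subset_span ⟨i, hi, rfl⟩)

theorem convex_boxSum {I : Set ℝ} (hI : Convex ℝ I) (v : ι → V) (s : Finset ι) :
    Convex ℝ (boxSum I v s) := by
  rintro _ ⟨lam, hlam, rfl⟩ _ ⟨mu, hmu, rfl⟩ a b ha hb hab
  refine ⟨fun i => a • lam i + b • mu i, fun i => hI (hlam i) (hmu i) ha hb hab, ?_⟩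
  simp only [Finset.smul_sum, ← Finset.sum_add_distrib, add_smul, smul_assoc]

theorem convex_boxSum_section {I : Set ℝ} (hI : Convex ℝ I) (v : ι → V) (s : Finset ι) (x w : V) :
    Convex ℝ {r : ℝ | x + r • w ∈ boxSum I v s} := by
  intro r hr q hq a b ha hb hab
  have := convex_boxSum hI v s hr hq ha hb hab
  have e : x + (a • r + b • q) • w = a • (x + r • w) + b • (x + q • w) := by
    have hx : x = (a + b) • x := by rw [hab, one_smul]
    nth_rewrite 1 [hx]
    simp only [smul_add, add_smul, smul_assoc]
    abel
  simpa only [Set.mem_ofPred_eq, e] using this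

theorem isCompact_boxSum_section {I : Set ℝ} (hI : IsCompact I) (v : ι → V) (s : Finset ι)
    (x : V) {w : V} (hw : w ≠ 0) : IsCompact {r : ℝ | x + r • w ∈ boxSum I v s} := by
  obtain ⟨f, hf⟩ := Module.Projective.exists_dual_eq_one ℝ hw
  have hcont (g : Module.Dual ℝ V) :
      Continuous fun lam : ι → ℝ => g (∑ i ∈ s, lam i • v i - x) := by
    simp only [map_sub, map_sum, map_smul]
    fun_prop
  have hK : IsCompact ((Set.univ.pi fun _ : ι => I) ∩ ⋂ g : Module.Dual ℝ V,
      {lam | g (∑ i ∈ s, lam i • v i - x) = f (∑ i ∈ s, lam i • v i - x) * g w}) :=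
    (isCompact_univ_pi fun _ => hI).inter_right (isClosed_iInter fun g =>
      isClosed_eq (hcont g) ((hcont f).mul continuous_const))
  convert hK.image (hcont f) using 1
  ext r
  constructor
  · rintro ⟨lam, hlam, h⟩
    have h' : ∑ i ∈ s, lam i • v i - x = r • w := by rw [← h]; abel
    refine ⟨lam, ⟨fun i _ => hlam i, Set.mem_iInter.2 fun g => ?_⟩, ?_⟩
    · simp only [Set.mem_ofPred_eq, h', map_smul, hf, smul_eq_mul, mul_one]
    · simp only [h', map_smul, hf, smul_eq_mul, mul_one]
  · rintro ⟨lam, ⟨hlam, hg⟩, rfl⟩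
    refine ⟨lam, fun i => hlam i trivial, ?_⟩
    rw [← sub_eq_zero, ← Module.forall_dual_apply_eq_zero_iff ℝ]
    intro g
    have := Set.mem_iInter.1 hg g
    simp only [Set.mem_ofPred_eq] at this
    rw [map_sub, map_add, map_smul, smul_eq_mul, ← this, map_sub]
    ring

end BoxSum

theorem existsUnique_int_mem_add_Icc_diff {S : Set ℝ} (hS : IsCompact S) (hconv : Convex ℝ S)
    (hne : S.Nonempty) :
    ∃! k : ℤ, (∃ l ∈ Set.Icc (0 : ℝ) 1, (k : ℝ) - l ∈ S) ∧ (k : ℝ) ∉ S := by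
  have hIcc := eq_Icc_of_connected_compact ⟨hne, hconv.isPreconnected⟩ hS
  generalize sInf S = a at hIcc
  generalize sSup S = b at hIcc
  subst hIcc
  have hab : a ≤ b := Set.nonempty_Icc.1 hne
  refine ⟨⌊b⌋ + 1, ⟨⟨(⌊b⌋ + 1 : ℝ) - max a ⌊b⌋, ⟨?_, ?_⟩, ?_⟩, ?_⟩, ?_⟩
  · rw [sub_nonneg, max_le_iff]
    exact ⟨by linarith [Int.lt_floor_add_one b], by linarith⟩
  · linarith [le_max_right a (⌊b⌋ : ℝ)]
  · push_cast
    rw [sub_sub_cancel]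
    exact ⟨le_max_left _ _, max_le hab (Int.floor_le b)⟩
  · push_cast
    exact fun h => (Int.lt_floor_add_one b).not_ge h.2
  · rintro k ⟨⟨l, ⟨h0, h1⟩, ⟨h2, h3⟩⟩, hk⟩
    have hbk : b < k := by
      by_contra! h
      exact hk ⟨by linarith, h⟩
    have := Int.floor_eq_iff.2 (⟨by push_cast; linarith, by push_cast; linarith⟩ :
      ((k - 1 : ℤ) : ℝ) ≤ b ∧ b < ((k - 1 : ℤ) : ℝ) + 1)
    omega

theorem encard_eq_of_existsUnique_add_mem {G : Type*} [AddCommGroup G] {H : AddSubgroup G}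
    {D : Set G} {Q : Set (G ⧸ H)} (hD : ∀ g ∈ D, (g : G ⧸ H) ∈ Q)
    (hQ : ∀ g : G, (g : G ⧸ H) ∈ Q → ∃! h : H, g + h ∈ D) : D.encard = Q.encard := by
  have hinj : Set.InjOn (QuotientAddGroup.mk : G → G ⧸ H) D := by
    intro g hg g' hg' h
    obtain ⟨k, -, hk⟩ := hQ g (hD g hg)
    have h0 := hk 0 (by simpa)
    have h1 := hk ⟨-g + g', QuotientAddGroup.eq.1 h⟩ (by simpa)
    have := congrArg Subtype.val (h1.trans h0.symm)
    exact (neg_add_eq_zero.1 this)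
  rw [← hinj.encard_image]
  congr 1
  ext q
  constructor
  · rintro ⟨g, hg, rfl⟩
    exact hD g hg
  · obtain ⟨g, rfl⟩ := QuotientAddGroup.mk_surjective q
    intro hq
    obtain ⟨h, hh, -⟩ := hQ g hq
    exact ⟨_, hh, by simp⟩

/-- The points over a translated zonotope are counted by those over the translated half-open
parallelepipeds spanned by its linearly independent subfamilies. The induction on the generators
passes to the quotients of `G` and `V` by the last generator: each class over the projected
zonotope has exactly one representative over the part added by that generator. -/
theorem encard_boxSum_Icc_eq_sum {ι : Type*} (s : Finset ι) :
    ∀ {G V : Type*} [AddCommGroup G] [AddCommGroup V] [Module ℝ V] (φ : G →+ V) (u : ι → G)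
      (p : V), {g | φ g - p ∈ boxSum (Set.Icc 0 1) (φ ∘ u) s}.encard =
        ∑ W ∈ s.powerset, if LinearIndepOn ℝ (φ ∘ u) (W : Set ι) then
          {g | φ g - p ∈ boxSum (Set.Ico 0 1) (φ ∘ u) W}.encard else 0 := by
  induction s using Finset.induction_on with
  | empty =>
    intro G V _ _ _ φ u p
    have h (I : Set ℝ) (hI : 0 ∈ I) : boxSum I (φ ∘ u) ∅ = {0} :=
      Set.eq_singleton_iff_unique_mem.2 ⟨⟨0, fun _ => hI, by simp⟩, by rintro _ ⟨_, -, rfl⟩; simp⟩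
    simp [h (Set.Icc 0 1) (by simp), h (Set.Ico 0 1) (by simp)]
  | insert a s ha ih =>
    intro G V _ _ _ φ u p
    rw [Finset.sum_powerset_insert ha, ← ih]
    have hsub : {g | φ g - p ∈ boxSum (Set.Icc 0 1) (φ ∘ u) s} ⊆
        {g | φ g - p ∈ boxSum (Set.Icc 0 1) (φ ∘ u) (insert a s)} := fun g hg =>
      (mem_boxSum_insert ha).2 ⟨0, by simp, by simpa using hg⟩
    rw [← Set.encard_sdiff_add_encard_of_subset hsub, add_comm]
    congr 1
    by_cases hw : φ (u a) = 0
    · rw [Finset.sum_eq_zero, Set.encard_eq_zero, Set.sdiff_eq_empty]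
      · intro g hg
        obtain ⟨r, -, h⟩ := (mem_boxSum_insert ha).1 hg
        simpa [hw] using h
      · intro W _
        rw [if_neg]
        intro h
        exact h.ne_zero (i := a) (by simp) hw
    let H := AddSubgroup.zmultiples (u a)
    let P := Submodule.span ℝ {φ (u a)}
    let ψ : G ⧸ H →+ V ⧸ P := QuotientAddGroup.lift H (P.mkQ.toAddMonoidHom.comp φ) (by
      rw [AddSubgroup.zmultiples_le]
      exact (Submodule.Quotient.mk_eq_zero P).2 (Submodule.mem_span_singleton_self _))
    have hψ : ψ ∘ (fun i => (u i : G ⧸ H)) = P.mkQ ∘ (φ ∘ u) := rfl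
    have hmem (I : Set ℝ) (t : Finset ι) (g : G) :
        ψ (g : G ⧸ H) - P.mkQ p ∈ boxSum I (ψ ∘ fun i => (u i : G ⧸ H)) t ↔
          ∃ r : ℝ, φ g - p + r • φ (u a) ∈ boxSum I (φ ∘ u) t := by
      rw [hψ, mem_boxSum_map]
      have e : ψ (g : G ⧸ H) - P.mkQ p = P.mkQ (φ g - p) := rfl
      rw [e]
      constructor
      · rintro ⟨x, hx, h⟩
        obtain ⟨r, hr⟩ := Submodule.mem_span_singleton.1 ((Submodule.Quotient.eq P).1 h)
        exact ⟨r, by rwa [hr, add_sub_cancel]⟩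
      · rintro ⟨r, hr⟩
        refine ⟨_, hr, (Submodule.Quotient.eq P).2 ?_⟩
        rw [add_sub_cancel_left]
        exact Submodule.smul_mem _ _ (Submodule.mem_span_singleton_self _)
    have hshift (g : G) (k : ℤ) : φ (g + k • u a) - p = φ g - p + (k : ℝ) • φ (u a) := by
      rw [map_add, map_zsmul, ← Int.cast_smul_eq_zsmul ℝ]
      abel
    have hshift' (g : G) (k l : ℝ) : φ g - p + k • φ (u a) - l • (φ ∘ u) a =
        φ g - p + (k - l) • φ (u a) := by
      rw [sub_smul, Function.comp_apply]
      abel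
    have key (D : Set G) (I : Set ℝ) (t : Finset ι)
        (hD : ∀ g ∈ D, ∃ r : ℝ, φ g - p + r • φ (u a) ∈ boxSum I (φ ∘ u) t)
        (hQ : ∀ g, {r : ℝ | φ g - p + r • φ (u a) ∈ boxSum I (φ ∘ u) t}.Nonempty →
          ∃! k : ℤ, g + k • u a ∈ D) :
        D.encard = {q | ψ q - P.mkQ p ∈ boxSum I (ψ ∘ fun i => (u i : G ⧸ H)) t}.encard := by
      refine encard_eq_of_existsUnique_add_mem (fun g hg => (hmem I t g).2 (hD g hg)) ?_
      intro g hg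
      obtain ⟨k, hk, huniq⟩ := hQ g ((hmem I t g).1 hg)
      refine ⟨⟨k • u a, k, rfl⟩, hk, ?_⟩
      rintro ⟨_, m, rfl⟩ hm
      exact Subtype.ext (congrArg (· • u a) (huniq m hm))
    rw [key _ (Set.Icc 0 1) s, ih ψ (fun i => (u i : G ⧸ H)) (P.mkQ p)]
    · refine Finset.sum_congr rfl fun W hW => ?_
      have haW : a ∉ W := fun h => ha (Finset.mem_powerset.1 hW h)
      have hiff : LinearIndepOn ℝ (φ ∘ u) ((insert a W : Finset ι) : Set ι) ↔
          LinearIndepOn ℝ (ψ ∘ fun i => (u i : G ⧸ H)) (W : Set ι) := by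
        have := linearIndepOn_union_iff_quotient (R := ℝ) (f := φ ∘ u) (s := {a}) (t := W)
          (by simpa)
        rw [Finset.coe_insert, Set.insert_eq, this, and_iff_right, Set.image_singleton]
        · rfl
        · exact LinearIndepOn.singleton hw
      rw [if_congr hiff.symm rfl rfl]
      split_ifs with hli
      swap
      · rfl
      symm
      rw [Finset.coe_insert, linearIndepOn_insert (by simpa)] at hli
      apply key
      · intro g hg
        obtain ⟨r, -, h⟩ := (mem_boxSum_insert haW).1 hg
        exact ⟨-r, by rwa [neg_smul, ← sub_eq_add_neg]⟩
      · rintro g ⟨b, hb⟩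
        have huniq (r : ℝ) : φ g - p + r • φ (u a) ∈ boxSum (Set.Ico 0 1) (φ ∘ u) W ↔ r = b := by
          refine ⟨fun hr => ?_, fun h => h ▸ hb⟩
          by_contra hne
          apply hli.2
          have := Submodule.sub_mem _ (boxSum_subset_span _ _ _ hr) (boxSum_subset_span _ _ _ hb)
          rw [add_sub_add_left_eq_sub, ← sub_smul] at this
          exact (Submodule.smul_mem_iff _ (sub_ne_zero.2 hne)).1 this
        simp only [Set.mem_ofPred_eq, mem_boxSum_insert haW, hshift, hshift', huniq]
        refine ⟨⌈b⌉, ⟨⌈b⌉ - b, ⟨?_, ?_⟩, by ring⟩, ?_⟩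
        · linarith [Int.le_ceil b]
        · linarith [Int.ceil_lt_add_one b]
        · rintro k ⟨l, ⟨h0, h1⟩, rfl⟩
          exact (Int.ceil_eq_iff.2 ⟨by linarith, by linarith⟩).symm
    · rintro g ⟨hg, -⟩
      obtain ⟨r, -, h⟩ := (mem_boxSum_insert ha).1 hg
      exact ⟨-r, by rwa [neg_smul, ← sub_eq_add_neg]⟩
    · intro g hne
      simpa only [Set.mem_sdiff, Set.mem_ofPred_eq, mem_boxSum_insert ha, hshift', hshift] using
        existsUnique_int_mem_add_Icc_diff (isCompact_boxSum_section isCompact_Icc _ s _ hw)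
          (convex_boxSum_section (convex_Icc 0 1) _ s _ _) hne

theorem mem_span_image_finset_iff_exists_sum {R ι M : Type*} [Ring R] [AddCommGroup M]
    [Module R M] {v : ι → M} {W : Finset ι} {x : M} :
    x ∈ Submodule.span R (v '' (W : Set ι)) ↔ ∃ c : ι → R, ∑ i ∈ W, c i • v i = x := by
  rw [Submodule.mem_span_image_finset_iff_exists_fun]
  constructor
  · rintro ⟨c, rfl⟩
    refine ⟨fun i => if h : i ∈ W then c ⟨i, h⟩ else 0, ?_⟩
    rw [← Finset.sum_coe_sort]
    exact Finset.sum_congr rfl fun i _ => by simp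
  · rintro ⟨c, rfl⟩
    exact ⟨fun i => c i, Finset.sum_coe_sort W fun i => c i • v i⟩

section LatticeSpan

variable {ι G V : Type*} [AddCommGroup G] [AddCommGroup V] [Module ℝ V]

/-- The elements of `G` mapped by `φ` into the real span of `S`. -/
def realSpanComap (φ : G →+ V) (S : Set V) : AddSubgroup G :=
  (Submodule.span ℝ S).toAddSubgroup.comap φ

/-- The subgroup generated by `S`. -/
def intSpan (S : Set G) : AddSubgroup G := (Submodule.span ℤ S).toAddSubgroup

theorem intSpan_le_realSpanComap (φ : G →+ V) (u : ι → G) (W : Set ι) :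
    intSpan (u '' W) ≤ realSpanComap φ ((φ ∘ u) '' W) := by
  have : Submodule.span ℤ (u '' W) ≤
      AddSubgroup.toIntSubmodule (realSpanComap φ ((φ ∘ u) '' W)) := by
    rw [Submodule.span_le]
    rintro _ ⟨i, hi, rfl⟩
    exact Submodule.subset_span ⟨i, hi, rfl⟩
  exact this

/-- Each coset of the lattice points in the span of a linearly independent family meets the
translated half-open parallelepiped in as many points as the index of the generated sublattice. -/
theorem encard_boxSum_Ico (φ : G →+ V) (u : ι → G) (W : Finset ι)
    (hW : LinearIndepOn ℝ (φ ∘ u) (W : Set ι)) {p : V} {x₀ : G}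
    (hx₀ : φ x₀ - p ∈ Submodule.span ℝ ((φ ∘ u) '' (W : Set ι))) :
    {g | φ g - p ∈ boxSum (Set.Ico 0 1) (φ ∘ u) W}.encard =
      ENat.card (realSpanComap φ ((φ ∘ u) '' (W : Set ι)) ⧸
        (intSpan (u '' (W : Set ι))).addSubgroupOf
          (realSpanComap φ ((φ ∘ u) '' (W : Set ι)))) := by
  set Λ := realSpanComap φ ((φ ∘ u) '' (W : Set ι))
  set L := intSpan (u '' (W : Set ι))
  have hLΛ : L ≤ Λ := intSpan_le_realSpanComap φ u W
  rw [linearIndepOn_finset_iffₛ] at hW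
  rw [← Set.encard_univ, ← encard_eq_of_existsUnique_add_mem (H := L.addSubgroupOf Λ)
    (D := {g : Λ | φ (g + x₀) - p ∈ boxSum (Set.Ico 0 1) (φ ∘ u) W}) (Q := Set.univ)
    (fun _ _ => Set.mem_univ _),
    ← Function.Injective.encard_image (f := fun g : Λ => (g : G) + x₀)
      (fun g h e => Subtype.ext (add_right_cancel e))]
  · congr 1
    ext g
    constructor
    · intro hg
      refine ⟨⟨g - x₀, ?_⟩, ?_, by simp⟩
      · have := Submodule.sub_mem _ (boxSum_subset_span _ _ _ hg) hx₀
        rw [sub_sub_sub_cancel_right, ← map_sub] at this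
        exact this
      · simpa using hg
    · rintro ⟨h, hh, rfl⟩
      exact hh
  · intro g _
    have hg : φ (g + x₀) - p ∈ Submodule.span ℝ ((φ ∘ u) '' (W : Set ι)) := by
      rw [map_add, add_sub_assoc]
      exact Submodule.add_mem _ g.2 hx₀
    obtain ⟨r, hr⟩ := mem_span_image_finset_iff_exists_sum.1 hg
    have hadd (n : ι → ℤ) : φ (g + ∑ i ∈ W, n i • u i + x₀) - p =
        ∑ i ∈ W, (r i + n i) • (φ ∘ u) i := by
      simp only [add_smul, Finset.sum_add_distrib, hr]
      simp only [map_add, map_sum, map_zsmul, Int.cast_smul_eq_zsmul, Function.comp_apply]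
      abel
    have hsum (n : ι → ℤ) : ∑ i ∈ W, n i • u i ∈ L :=
      mem_span_image_finset_iff_exists_sum.2 ⟨n, rfl⟩
    refine ⟨⟨⟨∑ i ∈ W, (-⌊r i⌋) • u i, hLΛ (hsum fun i => -⌊r i⌋)⟩, hsum fun i => -⌊r i⌋⟩, ?_, ?_⟩
    · refine ⟨fun i => Int.fract (r i), fun i => ⟨Int.fract_nonneg _, Int.fract_lt_one _⟩, ?_⟩
      refine (hadd _).trans (Finset.sum_congr rfl fun i _ => ?_)
      rw [Int.cast_neg, ← sub_eq_add_neg, Int.self_sub_floor]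
    · rintro ⟨⟨h, hhΛ⟩, hhL⟩ ⟨lam, hlam, hh⟩
      obtain ⟨n, rfl⟩ := mem_span_image_finset_iff_exists_sum.1
        (show h ∈ Submodule.span ℤ (u '' (W : Set ι)) from hhL)
      have := hW _ _ ((hadd n).symm.trans hh)
      refine Subtype.ext (Subtype.ext (Finset.sum_congr rfl fun i hi => ?_))
      congr 1
      have h1 := hlam i
      rw [← this i hi] at h1
      have := Int.floor_eq_iff.2 (⟨by push_cast; linarith [h1.1], by push_cast; linarith [h1.2]⟩ :
        ((-n i : ℤ) : ℝ) ≤ r i ∧ r i < ((-n i : ℤ) : ℝ) + 1)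
      omega

theorem ncard_boxSum_Ico (φ : G →+ V) (u : ι → G) (W : Finset ι)
    (hW : LinearIndepOn ℝ (φ ∘ u) (W : Set ι)) {p : V} {x₀ : G}
    (hx₀ : φ x₀ - p ∈ Submodule.span ℝ ((φ ∘ u) '' (W : Set ι))) :
    {g | φ g - p ∈ boxSum (Set.Ico 0 1) (φ ∘ u) W}.ncard =
      (intSpan (u '' (W : Set ι))).relIndex (realSpanComap φ ((φ ∘ u) '' (W : Set ι))) := by
  rw [Set.ncard_def, encard_boxSum_Ico φ u W hW hx₀]
  rfl

theorem relIndex_intSpan_eq_natAbs_det {n : Type*} [Fintype n] [DecidableEq n] {v w : n → G}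
    (hv : LinearIndependent ℤ v) (hw : LinearIndependent ℤ w) (A : Matrix n n ℤ)
    (hA : ∀ j, w j = ∑ i, A i j • v i) :
    (intSpan (Set.range w)).relIndex (intSpan (Set.range v)) = A.det.natAbs := by
  have hle : intSpan (Set.range w) ≤ intSpan (Set.range v) := by
    have : Submodule.span ℤ (Set.range w) ≤ Submodule.span ℤ (Set.range v) := by
      rw [Submodule.span_le]
      rintro _ ⟨j, rfl⟩
      exact (Submodule.mem_span_range_iff_exists_fun ℤ).2 ⟨fun i => A i j, (hA j).symm⟩
    exact this
  have hbasis {v : n → G} (hv : LinearIndependent ℤ v) :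
      ∃ b : Module.Basis n ℤ (AddSubgroup.toIntSubmodule (intSpan (Set.range v))),
        ∀ j, (b j : G) = v j :=
    ⟨Module.Basis.span hv, fun j => congrArg Subtype.val (Module.Basis.span_apply hv j)⟩
  obtain ⟨b₁, hb₁⟩ := hbasis hw
  obtain ⟨b₂, hb₂⟩ := hbasis hv
  rw [AddSubgroup.relIndex_eq_natAbs_det _ _ hle b₁ b₂, Module.Basis.det_apply]
  congr 2
  ext i j
  rw [Module.Basis.toMatrix_apply]
  have hsum : (⟨b₁ j, hle (SetLike.coe_mem _)⟩ :
      AddSubgroup.toIntSubmodule (intSpan (Set.range v))) = ∑ i, A i j • b₂ i := by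
    ext
    simp [hb₁, hb₂, hA]
  rw [hsum]
  simp [Finsupp.single_apply]

theorem relIndex_intSpan_smul (W : Finset G) (hW : LinearIndepOn ℤ id (W : Set G)) (t : ℕ)
    (ht : 0 < t) :
    (intSpan ((fun x => (t : ℤ) • x) '' (W : Set G))).relIndex (intSpan (W : Set G)) =
      t ^ W.card := by
  have h : LinearIndependent ℤ fun w : W => (w : G) := hW
  have h' : LinearIndependent ℤ fun w : W => (t : ℤ) • (w : G) := by
    rw [Fintype.linearIndependent_iff] at h ⊢
    intro g hg i
    have := h (fun i => g i * t) (by simpa only [mul_smul] using hg) i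
    simpa [ht.ne'] using this
  have := relIndex_intSpan_eq_natAbs_det h h' (Matrix.diagonal fun _ => (t : ℤ)) (fun j => by
    simp [Matrix.diagonal_apply, ite_smul])
  rw [Matrix.det_diagonal] at this
  rw [Set.image_eq_range]
  simpa [Int.natAbs_pow] using this

end LatticeSpan

section IntegerVectors

variable {d : ℕ}

/-- The inclusion of the integer vectors into the real vectors, as a homomorphism. -/
def castVecHom (d : ℕ) : (Fin d → ℤ) →+ (Fin d → ℝ) := (Int.castAddHom ℝ).compLeft (Fin d)

theorem coe_castVecHom : ⇑(castVecHom d) = castVec := rfl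

theorem castVec_sum_smul {ι : Type*} (s : Finset ι) (n : ι → ℤ) (b : ι → Fin d → ℤ) :
    castVec (∑ i ∈ s, n i • b i) = ∑ i ∈ s, (n i : ℝ) • castVec (b i) := by
  simp only [← coe_castVecHom, map_sum, map_zsmul, Int.cast_smul_eq_zsmul]

theorem linearIndependent_int_of_castVec {ι : Type*} {v : ι → Fin d → ℤ}
    (h : LinearIndependent ℝ fun i => castVec (v i)) : LinearIndependent ℤ v :=
  (h.restrict_scalars' ℤ).of_comp (castVecHom d).toIntLinearMap

theorem zonotopeF_eq_boxSum (W : Finset (Fin d → ℤ)) :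
    zonotopeF W = boxSum (Set.Icc 0 1) castVec W := rfl

theorem direction_affineSpan_zonotopeF (W : Finset (Fin d → ℤ)) :
    (affineSpan ℝ (zonotopeF W)).direction =
      Submodule.span ℝ (castVec '' (W : Set (Fin d → ℤ))) := by
  have h0 : (0 : Fin d → ℝ) ∈ zonotopeF W := ⟨0, by simp, by simp⟩
  rw [direction_affineSpan, vectorSpan_eq_span_vsub_set_right ℝ h0]
  simp only [vsub_eq_sub, sub_zero, Set.image_id']
  refine le_antisymm (Submodule.span_le.2 (boxSum_subset_span _ _ _))
    (Submodule.span_mono ?_)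
  rintro _ ⟨w, hw, rfl⟩
  refine ⟨fun u => if u = w then 1 else 0, fun u => ?_, ?_⟩
  · dsimp only
    split_ifs <;> simp
  · simpa using fun h => (h hw).elim

/-- The index in `span_ℝ(W) ∩ ℤ^d` of the lattice generated by `W`. -/
def zonotopeIndex (W : Finset (Fin d → ℤ)) : ℕ :=
  (intSpan (W : Set (Fin d → ℤ))).relIndex
    (realSpanComap (castVecHom d) (castVec '' (W : Set (Fin d → ℤ))))

theorem isRelVolOf_zonotopeF {W : Finset (Fin d → ℤ)} (hW : LinIndepF W) :
    IsRelVolOf (zonotopeF W) W.card (zonotopeIndex W) := by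
  intro v₀ b hv₀ hb hdir
  rw [direction_affineSpan_zonotopeF] at hdir
  let e : Fin W.card ≃ W := W.equivFin.symm
  let w : Fin W.card → Fin d → ℤ := fun j => (e j : Fin d → ℤ)
  have hrange : Set.range w = (W : Set (Fin d → ℤ)) := by
    have : w = Subtype.val ∘ e := rfl
    rw [this, e.surjective.range_comp]
    simp
  have hwR : LinearIndependent ℝ fun j => castVec (w j) :=
    LinearIndependent.comp hW e e.injective
  have hlat : realSpanComap (castVecHom d) (castVec '' (W : Set (Fin d → ℤ))) =
      intSpan (Set.range b) := by
    ext x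
    exact hdir x
  have hmem (j : Fin W.card) : ∃ n : Fin W.card → ℤ, ∑ i, n i • b i = w j := by
    rw [← Submodule.mem_span_range_iff_exists_fun ℤ, ← hdir]
    exact Submodule.subset_span ⟨w j, (e j).2, rfl⟩
  choose A hA using hmem
  have hbR : LinearIndependent ℝ fun i => castVec (b i) := by
    rw [linearIndependent_iff_card_le_finrank_span, Set.finrank, ← finrank_span_eq_card hwR]
    refine Submodule.finrank_mono (Submodule.span_le.2 ?_)
    rintro _ ⟨j, rfl⟩
    simp only [← hA, castVec_sum_smul]
    exact Submodule.sum_mem _ fun i _ => Submodule.smul_mem _ _ (Submodule.subset_span ⟨i, rfl⟩)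
  have hv₀' : castVec v₀ ∈ Submodule.span ℝ (castVec '' (W : Set (Fin d → ℤ))) :=
    boxSum_subset_span _ _ _ hv₀
  obtain ⟨n, hn⟩ := (Submodule.mem_span_range_iff_exists_fun ℤ).1 ((hdir v₀).1 hv₀')
  let M : Matrix (Fin W.card) (Fin W.card) ℤ := Matrix.of fun i j => A j i
  have hM (mu : Fin W.card → ℝ) : ∑ j, mu j • castVec (w j) =
      ∑ i, (M.map (Int.cast : ℤ → ℝ)).mulVec mu i • castVec (b i) := by
    simp only [← hA, castVec_sum_smul, Finset.smul_sum, Matrix.mulVec, dotProduct,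
      Finset.sum_smul, smul_smul]
    rw [Finset.sum_comm]
    simp [M, mul_comm]
  have hset : {lam : Fin W.card → ℝ | castVec v₀ + ∑ i, lam i • castVec (b i) ∈ zonotopeF W} =
      (fun lam => (fun i => (n i : ℝ)) + lam) ⁻¹'
        (Matrix.toLin' (M.map (Int.cast : ℤ → ℝ)) '' Set.Icc 0 1) := by
    ext lam
    have hsum : castVec v₀ + ∑ i, lam i • castVec (b i) =
        ∑ i, ((fun i => (n i : ℝ)) + lam) i • castVec (b i) := by
      simp only [← hn, castVec_sum_smul, Pi.add_apply, add_smul, Finset.sum_add_distrib]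
    have hreindex (f : (Fin d → ℤ) → ℝ) :
        ∑ u ∈ W, f u • castVec u = ∑ j, f (w j) • castVec (w j) := by
      rw [← Finset.sum_coe_sort]
      exact (e.sum_comp fun u : W => f u • castVec (u : Fin d → ℤ)).symm
    have hinj (x y : Fin W.card → ℝ)
        (h : ∑ i, x i • castVec (b i) = ∑ i, y i • castVec (b i)) : x = y :=
      funext fun i => (Fintype.linearIndependent_iffₛ.1 hbR) x y h i
    simp only [Set.mem_ofPred_eq, Set.mem_preimage, hsum]
    constructor
    · rintro ⟨f, hf, h⟩
      refine ⟨fun j => f (w j), ⟨fun j => (hf _).1, fun j => (hf _).2⟩, ?_⟩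
      rw [Matrix.toLin'_apply]
      apply hinj
      rw [h, hreindex, hM]
    · rintro ⟨mu, hmu, h⟩
      refine ⟨fun u => if hu : u ∈ W then mu (e.symm ⟨u, hu⟩) else 0, fun u => ?_, ?_⟩
      · dsimp only
        split_ifs
        · exact ⟨hmu.1 _, hmu.2 _⟩
        · simp
      · rw [← h, hreindex, Matrix.toLin'_apply, ← hM]
        simp [w]
  rw [hset, measure_preimage_add, Measure.addHaar_image_linearMap, LinearMap.det_toLin',
    Real.volume_Icc_pi]
  have hdet : (M.map (Int.cast : ℤ → ℝ)).det = (M.det : ℝ) :=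
    ((Int.castRingHom ℝ).map_det M).symm
  have hindex : zonotopeIndex W = M.det.natAbs := by
    rw [zonotopeIndex, hlat, ← hrange]
    exact relIndex_intSpan_eq_natAbs_det hb (linearIndependent_int_of_castVec hwR) M
      fun j => (hA j).symm
  rw [hindex, hdet]
  simp [Nat.cast_natAbs]

theorem finite_castVec_sub_mem_boxSum {ι : Type*} (u : ι → Fin d → ℤ) (s : Finset ι)
    (p : Fin d → ℝ) :
    {x | castVecHom d x - p ∈ boxSum (Set.Icc 0 1) (castVecHom d ∘ u) s}.Finite := by
  let B : Fin d → ℝ := fun k => ∑ i ∈ s, |(u i k : ℝ)|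
  refine (Set.finite_Icc (fun k => ⌊p k - B k⌋) (fun k => ⌈p k + B k⌉)).subset ?_
  rintro x ⟨lam, hlam, h⟩
  have hbound (k : Fin d) : |(x k : ℝ) - p k| ≤ B k := by
    have hk : (x k : ℝ) - p k = ∑ i ∈ s, lam i * u i k := by
      have := congrFun h k
      simpa [coe_castVecHom, castVec] using this
    rw [hk]
    refine (Finset.abs_sum_le_sum_abs _ _).trans (Finset.sum_le_sum fun i _ => ?_)
    rw [abs_mul, abs_of_nonneg (hlam i).1]
    exact mul_le_of_le_one_left (abs_nonneg _) (hlam i).2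
  refine ⟨fun k => ?_, fun k => ?_⟩
  · have := (abs_le.1 (hbound k)).1
    exact Int.cast_le.1 ((Int.floor_le _).trans (by linarith : p k - B k ≤ (x k : ℝ)))
  · have := (abs_le.1 (hbound k)).2
    exact Int.cast_le.1 ((by linarith : (x k : ℝ) ≤ p k + B k).trans (Int.le_ceil _))

theorem castVecHom_comp_smul (t : ℕ) :
    (castVecHom d ∘ fun x => (t : ℤ) • x) = (t : ℝ) • castVec := by
  ext x k
  simp [coe_castVecHom, castVec]

theorem span_smul_castVec_image {t : ℕ} (ht : 0 < t) (W : Set (Fin d → ℤ)) :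
    Submodule.span ℝ (((t : ℝ) • castVec) '' W) = Submodule.span ℝ (castVec '' W) := by
  have ht' : IsUnit (t : ℝ) := by simpa using ht.ne'
  rw [← Submodule.span_smul_eq_of_isUnit (castVec '' W) _ ht', ← Set.image_smul, Set.image_image]
  rfl

theorem linearIndepOn_smul_castVec {t : ℕ} (ht : 0 < t) (W : Finset (Fin d → ℤ)) :
    LinearIndepOn ℝ ((t : ℝ) • castVec) (W : Set (Fin d → ℤ)) ↔ LinIndepF W := by
  have ht' : (t : ℝ) ≠ 0 := by simpa using ht.ne'
  exact LinearIndependent.units_smul_iff (fun w : W => castVec w.1)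
    (fun _ => Units.mk0 (t : ℝ) ht')

theorem latCount_smul_vadd_zonotopeF (U : Finset (Fin d → ℤ)) (p : Fin d → ℝ) (t : ℕ) :
    latCount ((t : ℝ) • (p +ᵥ zonotopeF U)) =
      {x | castVecHom d x - (t : ℝ) • p ∈
        boxSum (Set.Icc 0 1) (castVecHom d ∘ fun x => (t : ℤ) • x) U}.ncard := by
  unfold latCount
  congr 1
  ext x
  have := mem_boxSum_map (I := Set.Icc 0 1) (v := castVec) (s := U)
    ((t : ℝ) • (LinearMap.id : (Fin d → ℝ) →ₗ[ℝ] _)) (y := castVecHom d x - (t : ℝ) • p)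
  rw [castVecHom_comp_smul]
  refine Iff.trans ?_ this.symm
  simp only [Set.mem_ofPred_eq, Set.mem_smul_set, Set.mem_vadd_set, zonotopeF_eq_boxSum]
  constructor
  · rintro ⟨_, ⟨z, hz, rfl⟩, h⟩
    exact ⟨z, hz, by simp [coe_castVecHom, ← h]⟩
  · rintro ⟨z, hz, h⟩
    exact ⟨_, ⟨z, hz, rfl⟩, by simpa [coe_castVecHom, eq_sub_iff_add_eq'] using h⟩

theorem ncard_castVec_boxSum_Ico {W : Finset (Fin d → ℤ)} (hW : LinIndepF W) (p : Fin d → ℝ)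
    {t : ℕ} (ht : 0 < t) :
    {x | castVecHom d x - p ∈
        boxSum (Set.Ico 0 1) (castVecHom d ∘ fun x => (t : ℤ) • x) W}.ncard =
      if ∃ x : Fin d → ℤ, castVec x ∈
          p +ᵥ (Submodule.span ℝ (castVec '' (W : Set (Fin d → ℤ))) : Set (Fin d → ℝ))
      then zonotopeIndex W * t ^ W.card else 0 := by
  have hiff (x : Fin d → ℤ) : castVec x ∈
      p +ᵥ (Submodule.span ℝ (castVec '' (W : Set (Fin d → ℤ))) : Set (Fin d → ℝ)) ↔
      castVecHom d x - p ∈ Submodule.span ℝ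
        ((castVecHom d ∘ fun x => (t : ℤ) • x) '' (W : Set (Fin d → ℤ))) := by
    rw [castVecHom_comp_smul, span_smul_castVec_image ht, Set.mem_vadd_set_iff_neg_vadd_mem,
      vadd_eq_add, neg_add_eq_sub]
    rfl
  simp only [hiff]
  split_ifs with h
  · obtain ⟨x₀, hx₀⟩ := h
    rw [ncard_boxSum_Ico (castVecHom d) (fun x => (t : ℤ) • x) W ?_ hx₀]
    · have hΛ : realSpanComap (castVecHom d)
          ((castVecHom d ∘ fun x => (t : ℤ) • x) '' (W : Set (Fin d → ℤ))) =
          realSpanComap (castVecHom d) (castVec '' (W : Set (Fin d → ℤ))) := by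
        rw [castVecHom_comp_smul, realSpanComap, span_smul_castVec_image ht, realSpanComap]
      rw [hΛ, ← AddSubgroup.relIndex_mul_relIndex _ (intSpan (W : Set (Fin d → ℤ))) _,
        relIndex_intSpan_smul W (linearIndependent_int_of_castVec hW) t ht, mul_comm]
      · rfl
      · have : Submodule.span ℤ ((fun x => (t : ℤ) • x) '' (W : Set (Fin d → ℤ))) ≤
            Submodule.span ℤ (W : Set (Fin d → ℤ)) := by
          rw [Submodule.span_le]
          rintro _ ⟨x, hx, rfl⟩
          exact Submodule.smul_mem _ _ (Submodule.subset_span hx)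
        exact this
      · simpa using! intSpan_le_realSpanComap (castVecHom d) id (W : Set (Fin d → ℤ))
    · rwa [castVecHom_comp_smul, linearIndepOn_smul_castVec ht]
  · rw [← Set.ncard_empty (Fin d → ℤ)]
    congr 1
    exact Set.eq_empty_of_forall_notMem fun x hx => h ⟨x, boxSum_subset_span _ _ _ hx⟩

end IntegerVectors

/-- Ardila–Beck–McWhirter: for every positive integer `t`,
`#(t(c + Z(U)) ∩ ℤ^d) = Σ_W χ_W(t) · relvol(Z(W)) · t^{|W|}`, the sum running over all
linearly independent subsets `W ⊆ U`, where `χ_W(t) = 1` iff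
`(tc + span_ℝ(W)) ∩ ℤ^d ≠ ∅`. -/
theorem ehrhart_of_almost_integral_zonotope
    (d : ℕ) (U : Finset (Fin d → ℤ)) (c : Fin d → ℚ) :
    ∃ rv : Finset (Fin d → ℤ) → ℝ,
      (∀ W ∈ U.powerset, LinIndepF W → IsRelVolOf (zonotopeF W) W.card (rv W)) ∧
      (∀ t : ℕ, 0 < t →
        (latCount ((t : ℝ) • (ratVec c +ᵥ zonotopeF U)) : ℝ) =
          ∑ W ∈ U.powerset,
            if LinIndepF W then
              (if ∃ x : Fin d → ℤ, castVec x ∈ ((t : ℝ) • ratVec c) +ᵥ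
                  (Submodule.span ℝ (castVec '' (W : Set (Fin d → ℤ))) : Set (Fin d → ℝ))
               then (1 : ℝ) else 0) * rv W * (t : ℝ) ^ W.card
            else 0) := by
  refine ⟨fun W => zonotopeIndex W, fun W _ hW => isRelVolOf_zonotopeF hW, fun t ht => ?_⟩
  have hfin (W : Finset (Fin d → ℤ)) :=
    finite_castVec_sub_mem_boxSum (fun x => (t : ℤ) • x) W ((t : ℝ) • ratVec c)
  rw [latCount_smul_vadd_zonotopeF, Set.ncard_def, encard_boxSum_Icc_eq_sum, ENat.toNat_sum,
    Nat.cast_sum]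
  · refine Finset.sum_congr rfl fun W _ => ?_
    rw [castVecHom_comp_smul, linearIndepOn_smul_castVec ht, ← castVecHom_comp_smul]
    split_ifs with hW h
    · rw [← Set.ncard_def, ncard_castVec_boxSum_Ico hW _ ht, if_pos h]
      push_cast
      ring
    · rw [← Set.ncard_def, ncard_castVec_boxSum_Ico hW _ ht, if_neg h]
      simp
    · simp
  · intro W _
    split_ifs
    · exact Set.encard_ne_top_iff.2 ((hfin W).subset fun x hx =>
        boxSum_mono Set.Ico_subset_Icc_self _ _ hx)
    · simp
end
end

section
/- Let P ⊂ ℝ^d be a lattice polytope (of any dimension m ≤ d) and let c ∈ ℝ^d. Then the translated lattice point enumerator L_{(P,c)}(t) = #((c + tP) ∩ ℤ^d) agrees for all positive integers t with a polynomial in ℚ[x]; moreover, if L_{(P,c)} is not identically zero, then this polynomial has degree dim P and its leading coefficient equals the relative volume relvol(P). -/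
open Pointwise MeasureTheory
open scoped RealInnerProductSpace

noncomputable section

open Filter Topology in
/-- A linear relation between indicator functions of nonempty compact intervals forces the
coefficients to sum to zero. -/
theorem sum_eq_zero_of_sum_indicator_Icc {ι : Type*} (s : Finset ι) (a : ι → ℤ) (l r : ι → ℝ)
    (hlr : ∀ i ∈ s, l i ≤ r i)
    (h : ∀ x : ℝ, ∑ i ∈ s, (if l i ≤ x ∧ x ≤ r i then a i else 0) = 0) :
    ∑ i ∈ s, a i = 0 := by
  have key : ∀ x : ℝ, ∑ i ∈ s with l i = x, a i = 0 := by
    intro x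
    have ev (e : ℝ) : ∀ᶠ y in 𝓝[<] x, e < x → e < y := by
      by_cases he : e < x
      · filter_upwards [Ioo_mem_nhdsLT he] with y hy _ using hy.1
      · exact Eventually.of_forall fun y hy => absurd hy he
    have ev₂ : ∀ᶠ y in 𝓝[<] x, ∀ i ∈ s, (l i < x → l i < y) ∧ (r i < x → r i < y) :=
      (Filter.eventually_all_finset s).2 fun i _ => (ev (l i)).and (ev (r i))
    obtain ⟨y, hy, hyx⟩ := (ev₂.and self_mem_nhdsWithin).exists
    change y < x at hyx
    rw [Finset.sum_filter]
    have hxy := congrArg₂ (· - ·) (h x) (h y)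
    simp only [← Finset.sum_sub_distrib, sub_zero] at hxy
    refine Eq.trans (Finset.sum_congr rfl fun i hi => ?_) hxy
    obtain ⟨h1, h2⟩ := hy i hi
    have h3 := hlr i hi
    rcases lt_trichotomy (l i) x with hl | hl | hl
    · have := h1 hl
      by_cases hr : x ≤ r i
      · simp [hl.ne, hl.le, hr, this.le, hyx.le.trans hr]
      · simp [hl.ne, hr, not_le.2 (h2 (not_le.1 hr))]
    · subst hl
      simp [h3, not_le.2 hyx]
    · simp [hl.ne', not_le.2 hl, not_le.2 (hyx.trans hl)]
  classical
  rw [← Finset.sum_fiberwise_of_maps_to (t := s.image l) (g := l)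
    (fun i hi => Finset.mem_image_of_mem l hi)]
  exact Finset.sum_eq_zero fun x _ => key x

open Classical in
/-- The Euler characteristic of compact convex sets is well defined: a linear relation between
their indicator functions holds for the numbers `1` (nonempty) and `0` (empty) too. -/
theorem sum_ite_nonempty_eq_zero {ι : Type*} (s : Finset ι) (a : ι → ℤ) :
    ∀ (n : ℕ) (C : ι → Set (Fin n → ℝ)), (∀ i ∈ s, IsCompact (C i)) → (∀ i ∈ s, Convex ℝ (C i)) →
      (∀ x, ∑ i ∈ s, (if x ∈ C i then a i else 0) = 0) →
      ∑ i ∈ s, (if (C i).Nonempty then a i else 0) = 0 := by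
  intro n
  induction n with
  | zero =>
    intro C _ _ h
    refine Eq.trans (Finset.sum_congr rfl fun i _ => ?_) (h 0)
    congr 1
    exact propext ⟨fun ⟨x, hx⟩ => Subsingleton.elim x 0 ▸ hx, fun hx => ⟨0, hx⟩⟩
  | succ n ih =>
    intro C hcomp hconv h
    let J : ι → Set ℝ := fun i => (fun z : Fin (n + 1) → ℝ => z 0) '' C i
    have hslice : ∀ x : ℝ, ∑ i ∈ s, (if x ∈ J i then a i else 0) = 0 := by
      intro x
      have hC : ∑ i ∈ s, (if {z : Fin n → ℝ | Fin.cons x z ∈ C i}.Nonempty then a i else 0) = 0 := by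
        refine ih (fun i => {z | Fin.cons x z ∈ C i}) ?_ ?_ fun z => by simpa using h (Fin.cons x z)
        · intro i hi
          have : {z : Fin n → ℝ | Fin.cons x z ∈ C i} =
              Fin.tail '' (C i ∩ {z : Fin (n + 1) → ℝ | z 0 = x}) := by
            ext z
            constructor
            · intro hz
              exact ⟨_, ⟨hz, by simp⟩, by simp⟩
            · rintro ⟨y, ⟨hy, rfl⟩, rfl⟩
              simpa using hy
          rw [this]
          refine IsCompact.image ?_ ?_
          · exact (hcomp i hi).inter_right (isClosed_eq (continuous_apply 0) continuous_const)
          · exact continuous_pi fun j => continuous_apply _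
        · intro i hi y hy z hz p q hp hq hpq
          have := hconv i hi hy hz hp hq hpq
          simp only [Set.mem_ofPred_eq] at this ⊢
          convert this using 1
          ext j
          refine Fin.cases ?_ (fun j => ?_) j
          · simp [← add_mul, hpq]
          · simp
      refine Eq.trans (Finset.sum_congr rfl fun i _ => ?_) hC
      congr 1
      refine propext ⟨?_, ?_⟩
      · rintro ⟨z, hz, rfl⟩
        exact ⟨Fin.tail z, by simpa using hz⟩
      · rintro ⟨z, hz⟩
        exact ⟨_, hz, by simp⟩
    have hJ : ∀ i ∈ s, (C i).Nonempty → J i = Set.Icc (sInf (J i)) (sSup (J i)) := by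
      intro i hi hne
      refine eq_Icc_of_connected_compact ?_ ((hcomp i hi).image (continuous_apply 0))
      exact ((hconv i hi).isConnected hne).image _ (continuous_apply 0).continuousOn
    rw [← Finset.sum_filter]
    refine sum_eq_zero_of_sum_indicator_Icc _ a (fun i => sInf (J i)) (fun i => sSup (J i)) ?_ ?_
    · intro i hi
      obtain ⟨hi, hne⟩ := Finset.mem_filter.1 hi
      have := hne.image (fun z : Fin (n + 1) → ℝ => z 0)
      change (J i).Nonempty at this
      rw [hJ i hi hne] at this
      exact Set.nonempty_Icc.1 this
    · intro x
      rw [Finset.sum_filter]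
      refine Eq.trans (Finset.sum_congr rfl fun i hi => ?_) (hslice x)
      by_cases hne : (C i).Nonempty
      · have : x ∈ J i ↔ sInf (J i) ≤ x ∧ x ≤ sSup (J i) := by
          conv_lhs => rw [hJ i hi hne]
          rfl
        simp [hne, this]
      · have : J i = ∅ := by simp [J, Set.not_nonempty_iff_eq_empty.1 hne]
        simp [hne, this]

/-- Dilates of the convex hull of a finite family in terms of nonnegative coefficients. -/
theorem mem_smul_convexHull_range {E : Type*} [AddCommGroup E] [Module ℝ E] {n : ℕ} [NeZero n]
    (w : Fin n → E) {h : ℝ} (hh : 0 ≤ h) (y : E) :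
    y ∈ h • convexHull ℝ (Set.range w) ↔
      ∃ lam : Fin n → ℝ, (∀ i, 0 ≤ lam i) ∧ ∑ i, lam i = h ∧ ∑ i, lam i • w i = y := by
  have himg : convexHull ℝ (Set.range w) =
      Fintype.linearCombination ℝ w '' stdSimplex ℝ (Fin n) := by
    rw [← convexHull_rangle_single_eq_stdSimplex, LinearMap.image_convexHull, ← Set.range_comp]
    congr 2
    ext i
    simp
  rw [himg, Set.mem_smul_set]
  constructor
  · rintro ⟨_, ⟨lam, ⟨h0, h1⟩, rfl⟩, rfl⟩
    refine ⟨fun i => h * lam i, fun i => mul_nonneg hh (h0 i), ?_, ?_⟩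
    · rw [← Finset.mul_sum, h1, mul_one]
    · simp [Fintype.linearCombination_apply, Finset.smul_sum, mul_smul]
  · rintro ⟨lam, h0, h1, rfl⟩
    rcases hh.eq_or_lt with rfl | hpos
    · have hz : ∀ i, lam i = 0 := fun i =>
        (Finset.sum_eq_zero_iff_of_nonneg fun i _ => h0 i).1 h1 i (Finset.mem_univ i)
      exact ⟨_, ⟨_, single_mem_stdSimplex ℝ (0 : Fin n), rfl⟩, by simp [hz]⟩
    · refine ⟨_, ⟨fun i => h⁻¹ * lam i, ⟨fun i => ?_, ?_⟩, rfl⟩, ?_⟩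
      · have := h0 i
        positivity
      · rw [← Finset.mul_sum, h1, inv_mul_cancel₀ hpos.ne']
      · simp [Fintype.linearCombination_apply, Finset.smul_sum, smul_smul, hpos.ne']

open Classical in
/-- An inclusion-exclusion identity between translated dilates of a polytope. -/
theorem sum_powerset_indicator_translate_dilate_eq_zero {d n : ℕ} [NeZero n]
    (w : Fin n → Fin d → ℝ) (t : ℕ) (y : Fin d → ℝ) :
    ∑ I ∈ (Finset.univ : Finset (Fin n)).powerset,
      (if y - ∑ i ∈ I, w i ∈ ((t + (n - I.card) : ℕ) : ℝ) • convexHull ℝ (Set.range w)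
        then (-1 : ℤ) ^ I.card else 0) = 0 := by
  let C : Finset (Fin n) → Set (Fin n → ℝ) := fun I =>
    {lam | (∀ i, 0 ≤ lam i) ∧ (∀ i ∈ I, 1 ≤ lam i) ∧ ∑ i, lam i = ((t + n : ℕ) : ℝ) ∧
      ∑ i, lam i • w i = y}
  have hC : ∀ I : Finset (Fin n),
      y - ∑ i ∈ I, w i ∈ ((t + (n - I.card) : ℕ) : ℝ) • convexHull ℝ (Set.range w) ↔
        (C I).Nonempty := by
    intro I
    have hI : I.card ≤ n := by simpa using I.card_le_univ
    have hcard : ∑ i, (if i ∈ I then (1 : ℝ) else 0) = I.card := by simp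
    have hsum : ∑ i, (if i ∈ I then (1 : ℝ) else 0) • w i = ∑ i ∈ I, w i := by simp
    rw [mem_smul_convexHull_range w (Nat.cast_nonneg _)]
    constructor
    · rintro ⟨lam, h0, h1, h2⟩
      refine ⟨fun i => lam i + if i ∈ I then 1 else 0, fun i => ?_, fun i hi => ?_, ?_, ?_⟩
      · have := h0 i
        dsimp only
        split_ifs <;> positivity
      · simpa [hi] using h0 i
      · rw [Finset.sum_add_distrib, h1, hcard]
        push_cast [hI]
        ring
      · simp only [add_smul]
        rw [Finset.sum_add_distrib, h2, hsum, sub_add_cancel]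
    · rintro ⟨lam, h0, h1, h2, h3⟩
      refine ⟨fun i => lam i - if i ∈ I then 1 else 0, fun i => ?_, ?_, ?_⟩
      · have := h0 i
        dsimp only
        split_ifs with hi
        · simpa using h1 i hi
        · simpa using this
      · rw [Finset.sum_sub_distrib, h2, hcard]
        push_cast [hI]
        ring
      · simp only [sub_smul]
        rw [Finset.sum_sub_distrib, h3, hsum]
  simp_rw [hC]
  refine sum_ite_nonempty_eq_zero _ (fun I => (-1 : ℤ) ^ I.card) n C ?_ ?_ ?_
  · intro I _
    refine (isCompact_Icc (a := (0 : Fin n → ℝ)) (b := fun _ => ((t + n : ℕ) : ℝ))).of_isClosed_subset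
      ?_ ?_
    · refine IsClosed.inter (s₁ := {lam : Fin n → ℝ | ∀ i, 0 ≤ lam i}) ?_ (IsClosed.inter
        (s₁ := {lam : Fin n → ℝ | ∀ i ∈ I, 1 ≤ lam i}) ?_ (IsClosed.inter
        (s₁ := {lam : Fin n → ℝ | ∑ i, lam i = ((t + n : ℕ) : ℝ)}) ?_
        (s₂ := {lam : Fin n → ℝ | ∑ i, lam i • w i = y}) ?_))
      · simp only [Set.ofPred_forall]
        exact isClosed_iInter fun i => isClosed_le continuous_const (continuous_apply i)
      · simp only [Set.ofPred_forall]
        exact isClosed_iInter fun i => isClosed_iInter fun _ =>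
          isClosed_le continuous_const (continuous_apply i)
      · exact isClosed_eq (by fun_prop) continuous_const
      · exact isClosed_eq (by fun_prop) continuous_const
    · rintro lam ⟨h0, -, h2, -⟩
      exact ⟨h0, fun i => h2 ▸ Finset.single_le_sum (fun j _ => h0 j) (Finset.mem_univ i)⟩
  · rintro I _ x ⟨x0, x1, x2, x3⟩ z ⟨z0, z1, z2, z3⟩ p q hp hq hpq
    refine ⟨fun i => ?_, fun i hi => ?_, ?_, ?_⟩
    · have := x0 i
      have := z0 i
      simp only [Pi.add_apply, Pi.smul_apply, smul_eq_mul]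
      positivity
    · have := mul_le_mul_of_nonneg_left (x1 i hi) hp
      have := mul_le_mul_of_nonneg_left (z1 i hi) hq
      simp only [Pi.add_apply, Pi.smul_apply, smul_eq_mul]
      linarith
    · simp only [Pi.add_apply, Pi.smul_apply, smul_eq_mul]
      rw [Finset.sum_add_distrib, ← Finset.mul_sum, ← Finset.mul_sum, x2, z2, ← add_mul, hpq,
        one_mul]
    · simp only [Pi.add_apply, Pi.smul_apply, smul_eq_mul, add_smul, mul_smul]
      rw [Finset.sum_add_distrib, ← Finset.smul_sum, ← Finset.smul_sum, x3, z3, ← add_smul, hpq,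
        one_smul]
  · intro lam
    by_cases hlam : (∀ i, 0 ≤ lam i) ∧ ∑ i, lam i = ((t + n : ℕ) : ℝ) ∧ ∑ i, lam i • w i = y
    · obtain ⟨h0, h1, h2⟩ := hlam
      let J : Finset (Fin n) := {i | 1 ≤ lam i}
      have hJ : J.Nonempty := by
        by_contra hne
        have hlt : ∀ i, lam i < 1 := by simpa [J, Finset.filter_eq_empty_iff] using hne
        have : ∑ i, lam i < ∑ _i : Fin n, (1 : ℝ) :=
          Finset.sum_lt_sum_of_nonempty Finset.univ_nonempty fun i _ => hlt i
        rw [h1] at this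
        simp at this
        have : (0 : ℝ) ≤ t := Nat.cast_nonneg t
        linarith
      have hmem (I : Finset (Fin n)) : I ∈ J.powerset ↔ lam ∈ C I := by
        simp [C, h0, h1, h2, J, Finset.subset_iff]
      clear_value C
      refine Eq.trans ?_ (Finset.sum_powerset_neg_one_pow_card_of_nonempty hJ)
      simp_rw [← hmem]
      rw [← Finset.sum_filter, Finset.filter_mem_eq_inter,
        Finset.inter_eq_right.2 (Finset.powerset_mono.2 (Finset.subset_univ J))]
    · refine Finset.sum_eq_zero fun I _ => if_neg ?_
      rintro ⟨h0, -, h1, h2⟩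
      exact hlam ⟨h0, h1, h2⟩

theorem castVec_add {d : ℕ} (x y : Fin d → ℤ) : castVec (x + y) = castVec x + castVec y := by
  ext i
  simp [castVec]

theorem castVec_sub {d : ℕ} (x y : Fin d → ℤ) : castVec (x - y) = castVec x - castVec y := by
  ext i
  simp [castVec]

theorem castVec_sum {d : ℕ} {ι : Type*} (s : Finset ι) (x : ι → Fin d → ℤ) :
    castVec (∑ i ∈ s, x i) = ∑ i ∈ s, castVec (x i) := by
  ext i
  simp [castVec]

theorem castVec_smul {d : ℕ} (n : ℤ) (x : Fin d → ℤ) :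
    castVec (n • x) = (n : ℝ) • castVec x := by
  ext i
  simp [castVec]

theorem castVec_injective {d : ℕ} : Function.Injective (castVec (d := d)) := by
  intro x y h
  ext i
  have := congrFun h i
  simpa [castVec] using this

/-- A bounded set contains only finitely many lattice points. -/
theorem finite_castVec_mem {d : ℕ} {S : Set (Fin d → ℝ)} (hS : Bornology.IsBounded S) :
    {x : Fin d → ℤ | castVec x ∈ S}.Finite := by
  obtain ⟨r, hr⟩ := hS.subset_closedBall 0
  refine (Set.finite_Icc (fun _ => ⌈-r⌉) (fun _ => ⌊r⌋ : Fin d → ℤ)).subset fun x hx => ?_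
  have hx' : ‖castVec x‖ ≤ r := by simpa using hr hx
  refine ⟨fun i => Int.ceil_le.2 ?_, fun i => Int.le_floor.2 ?_⟩
  · exact (abs_le.1 ((norm_le_pi_norm (castVec x) i).trans hx')).1
  · exact (abs_le.1 ((norm_le_pi_norm (castVec x) i).trans hx')).2

theorem latCount_mono {d : ℕ} {S T : Set (Fin d → ℝ)} (hT : Bornology.IsBounded T) (h : S ⊆ T) :
    latCount S ≤ latCount T :=
  Set.ncard_le_ncard (fun _ hx => h hx) (finite_castVec_mem hT)

/-- Lattice translations preserve the number of lattice points. -/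
theorem latCount_castVec_vadd {d : ℕ} (w : Fin d → ℤ) (S : Set (Fin d → ℝ)) :
    latCount (castVec w +ᵥ S) = latCount S := by
  have : {x : Fin d → ℤ | castVec x ∈ castVec w +ᵥ S} =
      (fun x => w + x) '' {x : Fin d → ℤ | castVec x ∈ S} := by
    ext x
    simp only [Set.mem_ofPred_eq, Set.mem_image, Set.mem_vadd_set, vadd_eq_add]
    constructor
    · rintro ⟨y, hy, hxy⟩
      refine ⟨x - w, ?_, by abel⟩
      rwa [castVec_sub, ← hxy, add_sub_cancel_left]
    · rintro ⟨y, hy, rfl⟩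
      exact ⟨_, hy, (castVec_add _ _).symm⟩
  rw [latCount, this, Set.ncard_image_of_injective _ (add_right_injective w), latCount]

/-- A function whose iterated forward differences of some order vanish is a polynomial. -/
theorem exists_polynomial_of_fwdDiff_iter_eq_zero (f : ℕ → ℚ) (n : ℕ)
    (h : ∀ t, (fwdDiff 1)^[n] f t = 0) :
    ∃ p : Polynomial ℚ, ∀ t : ℕ, f t = p.eval (t : ℚ) := by
  refine ⟨∑ k ∈ Finset.range n,
    Polynomial.C ((fwdDiff 1)^[k] f 0 / k.factorial) * descPochhammer ℚ k, fun t => ?_⟩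
  have hz : ∀ k, n ≤ k → (fwdDiff 1)^[k] f 0 = 0 := by
    intro k hk
    obtain ⟨j, rfl⟩ := Nat.exists_eq_add_of_le hk
    rw [add_comm, Function.iterate_add_apply, funext h]
    exact congrFun (Function.iterate_fixed (x := fun _ : ℕ => (0 : ℚ)) (by ext; simp [fwdDiff]) j) 0
  have hterm : ∀ k, (t.choose k • (fwdDiff 1)^[k] f 0 : ℚ) =
      (fwdDiff 1)^[k] f 0 / k.factorial * t.descFactorial k := by
    intro k
    rw [Nat.descFactorial_eq_factorial_mul_choose]
    have : (k.factorial : ℚ) ≠ 0 := by exact_mod_cast k.factorial_ne_zero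
    push_cast
    rw [nsmul_eq_mul]
    field_simp
  have := shift_eq_sum_fwdDiff_iter 1 f t 0
  simp only [smul_eq_mul, mul_one, zero_add] at this
  rw [this, Polynomial.eval_finsetSum]
  simp only [Polynomial.eval_mul, Polynomial.eval_C, descPochhammer_eval_eq_descFactorial, hterm]
  rcases le_total n (t + 1) with hn | hn
  · refine (Finset.sum_subset (Finset.range_mono hn) fun k _ hk => ?_).symm
    rw [hz k (by simpa using hk)]
    simp
  · refine Finset.sum_subset (Finset.range_mono hn) fun k _ hk => ?_
    rw [Nat.descFactorial_of_lt (by simpa using hk)]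
    simp

/-- Polynomiality of the translated lattice point enumerator. -/
theorem exists_polynomial_latCount {d : ℕ} {P : Set (Fin d → ℝ)} (hP : IsLatticePolytope P)
    (c : Fin d → ℝ) :
    ∃ p : Polynomial ℚ, ∀ t : ℕ, (latCount (c +ᵥ (t : ℝ) • P) : ℚ) = p.eval (t : ℚ) := by
  classical
  obtain ⟨V, hV, rfl⟩ := hP
  have : NeZero V.card := ⟨hV.card_ne_zero⟩
  set n := V.card
  let u : Fin n → Fin d → ℤ := fun i => (V.equivFin.symm i : Fin d → ℤ)
  let w : Fin n → Fin d → ℝ := fun i => castVec (u i)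
  have hw : castVec '' (V : Set (Fin d → ℤ)) = Set.range w := by
    have hu : Set.range u = (V : Set (Fin d → ℤ)) := by
      ext x
      constructor
      · rintro ⟨i, rfl⟩
        exact (V.equivFin.symm i).2
      · intro hx
        exact ⟨V.equivFin ⟨x, hx⟩, by simp [u]⟩
    rw [← hu, ← Set.range_comp]
    rfl
  rw [hw]
  have hbdd (a : Fin d → ℝ) (t : ℝ) :
      Bornology.IsBounded (a +ᵥ t • convexHull ℝ (Set.range w)) :=
    (((isBounded_convexHull.2 (Set.finite_range w).isBounded).smul₀ t).vadd a)
  set L : ℕ → ℕ := fun t => latCount (c +ᵥ (t : ℝ) • convexHull ℝ (Set.range w)) with hL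
  have hrel : ∀ t : ℕ, ∑ I ∈ (Finset.univ : Finset (Fin n)).powerset,
      (-1 : ℤ) ^ I.card * (L (t + (n - I.card)) : ℤ) = 0 := by
    intro t
    let T : Finset (Fin n) → Set (Fin d → ℤ) := fun I => {x | castVec x ∈
      castVec (∑ i ∈ I, u i) +ᵥ (c +ᵥ ((t + (n - I.card) : ℕ) : ℝ) • convexHull ℝ (Set.range w))}
    have hTfin : ∀ I, (T I).Finite := fun I => finite_castVec_mem ((hbdd _ _).vadd _)
    let B : Finset (Fin d → ℤ) := Finset.univ.biUnion fun I => (hTfin I).toFinset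
    have hcount : ∀ I, (L (t + (n - I.card)) : ℤ) = ∑ x ∈ B, if x ∈ T I then 1 else 0 := by
      intro I
      have hLT : L (t + (n - I.card)) = (T I).ncard := by
        simp only [hL]
        rw [← latCount_castVec_vadd (∑ i ∈ I, u i), latCount]
      rw [hLT, Finset.sum_boole, ← Set.ncard_coe_finset]
      congr 2
      ext x
      simp only [Finset.coe_filter, Set.mem_ofPred_eq]
      refine ⟨fun hx => ⟨?_, hx⟩, fun hx => hx.2⟩
      exact Finset.mem_biUnion.2 ⟨I, Finset.mem_univ I, (hTfin I).mem_toFinset.2 hx⟩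
    simp_rw [hcount, Finset.mul_sum]
    rw [Finset.sum_comm]
    refine Finset.sum_eq_zero fun x _ => ?_
    refine Eq.trans (Finset.sum_congr rfl fun I _ => ?_)
      (sum_powerset_indicator_translate_dilate_eq_zero w t (castVec x - c))
    have hx : x ∈ T I ↔ castVec x - c - ∑ i ∈ I, w i ∈
        ((t + (n - I.card) : ℕ) : ℝ) • convexHull ℝ (Set.range w) := by
      simp only [T, Set.mem_ofPred_eq, Set.mem_vadd_set_iff_neg_vadd_mem, vadd_eq_add, castVec_sum]
      rw [show -c + (-∑ i ∈ I, castVec (u i) + castVec x) = castVec x - c - ∑ i ∈ I, w i by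
        simp only [w]; abel]
    simp only [hx, mul_ite, mul_one, mul_zero]
  refine exists_polynomial_of_fwdDiff_iter_eq_zero (fun t => (L t : ℚ)) n fun t => ?_
  rw [fwdDiff_iter_eq_sum_shift, ← Finset.sum_range_reflect]
  have h1 := hrel t
  rw [Finset.sum_powerset_apply_card (fun m => (-1 : ℤ) ^ m * (L (t + (n - m)) : ℤ)),
    Finset.card_univ, Fintype.card_fin] at h1
  have h2 := congrArg (Int.cast : ℤ → ℚ) h1
  push_cast at h2
  rw [← h2]
  refine Finset.sum_congr rfl fun m hm => ?_
  have hm' : m ≤ n := Nat.lt_succ_iff.1 (Finset.mem_range.1 hm)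
  rw [show n + 1 - 1 - m = n - m by omega, Nat.sub_sub_self hm', Nat.choose_symm hm']
  simp
  ring

open Filter Topology

/-- The number of lattice points in dilates of a compact convex set grows like the volume. -/
theorem tendsto_latCount_smul_div_pow {k : ℕ} {Q : Set (Fin k → ℝ)} (hcomp : IsCompact Q)
    (hconv : Convex ℝ Q) :
    Tendsto (fun t : ℕ => (latCount ((t : ℝ) • Q) : ℝ) / (t : ℝ) ^ k) atTop
      (𝓝 (volume.real Q)) := by
  have h := tendsto_card_div_pow_atTop_volume Q hcomp.isBounded hcomp.measurableSet
    (hconv.addHaar_frontier volume)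
  rw [Fintype.card_fin] at h
  refine h.congr' ?_
  filter_upwards [eventually_gt_atTop 0] with t ht
  have : NeZero t := ⟨ht.ne'⟩
  have ht' : (t : ℝ) ≠ 0 := by exact_mod_cast ht.ne'
  congr 2
  rw [latCount, Nat.card_coe_set_eq, ← Set.ncard_image_of_injective (f := fun x : Fin k → ℤ =>
    (t : ℝ)⁻¹ • castVec x) _ ((smul_right_injective _ (inv_ne_zero ht')).comp castVec_injective)]
  congr 1
  ext y
  simp only [Set.mem_inter_iff, Set.mem_image, Set.mem_ofPred_eq,
    ← Submodule.coe_pointwise_smul, SetLike.mem_coe, BoxIntegral.unitPartition.mem_smul_span_iff]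
  constructor
  · rintro ⟨hy, hy'⟩
    choose x hx using hy'
    have hxy : castVec x = (t : ℝ) • y := funext hx
    exact ⟨x, hxy ▸ Set.smul_mem_smul_set hy, by rw [hxy, inv_smul_smul₀ ht']⟩
  · rintro ⟨x, hx, rfl⟩
    exact ⟨(Set.mem_smul_set_iff_inv_smul_mem₀ ht' _ _).1 hx,
      fun i => ⟨x i, by simp [castVec, ht']⟩⟩

/-- Every point lies in a lattice translate of a large dilate of a convex body. -/
theorem exists_nat_forall_exists_sub_castVec_mem_smul {k : ℕ} {Q : Set (Fin k → ℝ)}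
    (hint : (interior Q).Nonempty) :
    ∃ N : ℕ, ∀ γ : Fin k → ℝ, ∃ w : Fin k → ℤ, γ - castVec w ∈ (N : ℝ) • Q := by
  obtain ⟨q, hq⟩ := hint
  obtain ⟨ε, hε, hball⟩ := Metric.isOpen_iff.1 isOpen_interior q hq
  obtain ⟨N, hN⟩ := exists_nat_gt ε⁻¹
  have hN0 : (0 : ℝ) < N := (inv_pos.2 hε).trans hN
  refine ⟨N, fun γ => ⟨fun i => ⌊γ i - N * q i⌋, ?_⟩⟩
  rw [Set.mem_smul_set_iff_inv_smul_mem₀ hN0.ne']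
  refine interior_subset (hball ?_)
  rw [Metric.mem_ball, dist_pi_lt_iff hε]
  intro i
  have h1 := Int.fract_nonneg (γ i - N * q i)
  have h2 := Int.fract_lt_one (γ i - N * q i)
  have h3 : (N : ℝ)⁻¹ < ε := inv_lt_of_inv_lt₀ hε hN
  have h4 : ((N : ℝ)⁻¹ • (γ - castVec fun i => ⌊γ i - N * q i⌋)) i - q i =
      (N : ℝ)⁻¹ * Int.fract (γ i - N * q i) := by
    simp only [Pi.smul_apply, Pi.sub_apply, castVec, smul_eq_mul, Int.fract]
    field_simp
    ring
  rw [Real.dist_eq, h4, abs_of_nonneg (by positivity)]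
  refine lt_of_le_of_lt ?_ h3
  exact mul_le_of_le_one_right (by positivity) h2.le

/-- The number of lattice points in translated dilates of a convex body grows like the volume. -/
theorem tendsto_latCount_vadd_smul_div_pow {k : ℕ} {Q : Set (Fin k → ℝ)} (hcomp : IsCompact Q)
    (hconv : Convex ℝ Q) (hint : (interior Q).Nonempty) (γ : Fin k → ℝ) :
    Tendsto (fun t : ℕ => (latCount (γ +ᵥ (t : ℝ) • Q) : ℝ) / (t : ℝ) ^ k) atTop
      (𝓝 (volume.real Q)) := by
  obtain ⟨N, hN⟩ := exists_nat_forall_exists_sub_castVec_mem_smul hint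
  have hbdd (a : Fin k → ℝ) (t : ℝ) : Bornology.IsBounded (a +ᵥ t • Q) :=
    (hcomp.isBounded.smul₀ t).vadd a
  have hadd (t : ℕ) : ((t + N : ℕ) : ℝ) • Q = (t : ℝ) • Q + (N : ℝ) • Q := by
    push_cast
    exact hconv.add_smul t.cast_nonneg N.cast_nonneg
  have hcmp (α β : Fin k → ℝ) (t : ℕ) :
      latCount (α +ᵥ (t : ℝ) • Q) ≤ latCount (β +ᵥ ((t + N : ℕ) : ℝ) • Q) := by
    obtain ⟨w, hw⟩ := hN (α - β)
    rw [← latCount_castVec_vadd w (β +ᵥ _)]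
    refine latCount_mono ((hbdd _ _).vadd _) ?_
    rintro _ ⟨x, hx, rfl⟩
    refine ⟨_, ⟨x + (α - β - castVec w), ?_, rfl⟩, ?_⟩
    · rw [hadd]
      exact Set.add_mem_add hx hw
    · simp only [vadd_eq_add]
      abel
  have hlim := tendsto_latCount_smul_div_pow hcomp hconv
  have hratio := tendsto_natCast_div_add_atTop (N : ℝ)
  rw [← tendsto_add_atTop_iff_nat N]
  have hlow : Tendsto (fun t : ℕ => (latCount ((t : ℝ) • Q) : ℝ) / (t : ℝ) ^ k *
      ((t : ℝ) / (t + N)) ^ k) atTop (𝓝 (volume.real Q)) := by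
    simpa using hlim.mul (hratio.pow k)
  have hupp : Tendsto (fun t : ℕ => (latCount (((t + N + N : ℕ) : ℝ) • Q) : ℝ) /
      ((t + N + N : ℕ) : ℝ) ^ k * (2 - (t : ℝ) / (t + N)) ^ k) atTop (𝓝 (volume.real Q)) := by
    have h1 : Tendsto (fun t : ℕ => 2 - (t : ℝ) / (t + N)) atTop (𝓝 1) := by
      convert tendsto_const_nhds.sub hratio using 2
      norm_num
    have h2 : Tendsto (fun t : ℕ => t + N + N) atTop atTop :=
      tendsto_atTop_mono (fun t => by dsimp only [id]; omega) tendsto_id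
    simpa using (hlim.comp h2).mul (h1.pow k)
  refine tendsto_of_tendsto_of_tendsto_of_le_of_le' hlow hupp ?_ ?_
  · filter_upwards [eventually_gt_atTop 0] with t ht
    have ht' : (0 : ℝ) < t := by exact_mod_cast ht
    have hle : (latCount ((t : ℝ) • Q) : ℝ) ≤ latCount (γ +ᵥ ((t + N : ℕ) : ℝ) • Q) := by
      simpa using hcmp 0 γ t
    rw [div_pow, div_mul_div_cancel₀ (by positivity), Nat.cast_add]
    rw [Nat.cast_add] at hle
    gcongr
  · filter_upwards [eventually_gt_atTop 0] with t ht
    have ht' : (0 : ℝ) < t := by exact_mod_cast ht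
    have hle : (latCount (γ +ᵥ ((t + N : ℕ) : ℝ) • Q) : ℝ) ≤
        latCount (((t + N + N : ℕ) : ℝ) • Q) := by
      simpa using hcmp γ 0 (t + N)
    have hr : 2 - (t : ℝ) / (t + N) = ((t + N + N : ℕ) : ℝ) / ((t + N : ℕ) : ℝ) := by
      push_cast
      field_simp
      ring
    rw [hr, div_pow, div_mul_div_cancel₀ (by positivity)]
    gcongr

/-- A polynomial asymptotic to a positive multiple of `t ^ k` along the natural numbers has degree
`k` and the corresponding leading coefficient. -/
theorem natDegree_eq_and_leadingCoeff_eq_of_tendsto (p : Polynomial ℝ) (k : ℕ) {v : ℝ}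
    (hv : v ≠ 0)
    (h : Tendsto (fun t : ℕ => p.eval (t : ℝ) / (t : ℝ) ^ k) atTop (𝓝 v)) :
    p.natDegree = k ∧ p.leadingCoeff = v := by
  have hX : (Polynomial.X ^ k : Polynomial ℝ) ≠ 0 := pow_ne_zero _ Polynomial.X_ne_zero
  have heval : (fun t : ℕ => p.eval (t : ℝ) / (t : ℝ) ^ k) =
      (fun x => p.eval x / (Polynomial.X ^ k : Polynomial ℝ).eval x) ∘ (Nat.cast : ℕ → ℝ) := by
    ext t
    simp
  rw [heval] at h
  rcases lt_trichotomy p.degree (Polynomial.X ^ k : Polynomial ℝ).degree with hlt | heq | hgt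
  · exact absurd (tendsto_nhds_unique h ((Polynomial.div_tendsto_atTop_zero_of_degree_lt _ _
      hlt).comp tendsto_natCast_atTop_atTop)) hv
  · have h' := tendsto_nhds_unique h ((Polynomial.div_tendsto_atTop_leadingCoeff_div_of_degree_eq
      _ _ heq).comp tendsto_natCast_atTop_atTop)
    rw [Polynomial.leadingCoeff_X_pow, div_one] at h'
    rw [Polynomial.degree_X_pow] at heq
    exact ⟨Polynomial.natDegree_eq_of_degree_eq_some heq, h'.symm⟩
  · have h' := (Polynomial.abs_div_tendsto_atTop_atTop_of_degree_gt _ _ hgt hX).comp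
      tendsto_natCast_atTop_atTop
    exact absurd h.abs (not_tendsto_nhds_of_tendsto_atTop h' _)

/-- The real linear map sending the standard basis to the given integer vectors. -/
def castLin {d k : ℕ} (b : Fin k → Fin d → ℤ) : (Fin k → ℝ) →ₗ[ℝ] (Fin d → ℝ) :=
  Fintype.linearCombination ℝ fun i => castVec (b i)

theorem castLin_apply {d k : ℕ} (b : Fin k → Fin d → ℤ) (lam : Fin k → ℝ) :
    castLin b lam = ∑ i, lam i • castVec (b i) :=
  Fintype.linearCombination_apply ..

theorem castLin_castVec {d k : ℕ} (b : Fin k → Fin d → ℤ) (y : Fin k → ℤ) :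
    castLin b (castVec y) = castVec (∑ i, y i • b i) := by
  rw [castLin_apply, castVec_sum]
  simp only [castVec_smul, castVec]

/-- Integer vectors that are independent over the integers are independent over the reals. -/
theorem linearIndependent_castVec {d k : ℕ} {b : Fin k → Fin d → ℤ} (hb : LinearIndependent ℤ b) :
    LinearIndependent ℝ fun i => castVec (b i) :=
  (linearIndependent_algebraMap_comp_iff (R := ℤ) (S := ℝ)).2 hb

theorem castLin_injective {d k : ℕ} {b : Fin k → Fin d → ℤ} (hb : LinearIndependent ℤ b) :
    Function.Injective (castLin b) :=
  (linearIndependent_castVec hb).fintypeLinearCombination_injective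

/-- The direction of the affine hull of a lattice polytope is spanned by any basis of its
lattice points. -/
theorem range_castLin {d k : ℕ} {P : Set (Fin d → ℝ)} (hP : IsLatticePolytope P)
    {b : Fin k → Fin d → ℤ}
    (hspan : ∀ x : Fin d → ℤ,
      castVec x ∈ (affineSpan ℝ P).direction ↔ x ∈ Submodule.span ℤ (Set.range b)) :
    LinearMap.range (castLin b) = (affineSpan ℝ P).direction := by
  obtain ⟨V, hV, rfl⟩ := hP
  apply le_antisymm
  · rintro _ ⟨lam, rfl⟩
    rw [castLin_apply]
    exact Submodule.sum_mem _ fun i _ => Submodule.smul_mem _ _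
      ((hspan _).2 (Submodule.subset_span ⟨i, rfl⟩))
  · obtain ⟨v, hv⟩ := hV
    have hvm : castVec v ∈ castVec '' (V : Set (Fin d → ℤ)) := ⟨v, hv, rfl⟩
    rw [affineSpan_convexHull, direction_affineSpan,
      vectorSpan_eq_span_vsub_set_right ℝ hvm, Submodule.span_le]
    rintro _ ⟨_, ⟨u, hu, rfl⟩, rfl⟩
    have hmem : castVec (u - v) ∈
        (affineSpan ℝ (convexHull ℝ (castVec '' (V : Set (Fin d → ℤ))))).direction := by
      rw [affineSpan_convexHull, direction_affineSpan, castVec_sub]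
      exact vsub_mem_vectorSpan ℝ ⟨u, hu, rfl⟩ hvm
    obtain ⟨y, hy⟩ := (Submodule.mem_span_range_iff_exists_fun ℤ).1 ((hspan _).1 hmem)
    exact ⟨castVec y, by rw [castLin_castVec, hy, castVec_sub]; rfl⟩

/-- An embedding of lattices preserves the number of lattice points. -/
theorem latCount_image_castLin {d k : ℕ} {b : Fin k → Fin d → ℤ} (hb : LinearIndependent ℤ b)
    (hsat : ∀ x : Fin d → ℤ, castVec x ∈ LinearMap.range (castLin b) →
      x ∈ Submodule.span ℤ (Set.range b)) (S : Set (Fin k → ℝ)) :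
    latCount (castLin b '' S) = latCount S := by
  have : {x : Fin d → ℤ | castVec x ∈ castLin b '' S} =
      (fun y : Fin k → ℤ => ∑ i, y i • b i) '' {y : Fin k → ℤ | castVec y ∈ S} := by
    ext x
    constructor
    · rintro ⟨s, hs, hsx⟩
      obtain ⟨y, rfl⟩ := (Submodule.mem_span_range_iff_exists_fun ℤ).1 (hsat x ⟨s, hsx⟩)
      rw [← castLin_castVec] at hsx
      obtain rfl := castLin_injective hb hsx
      exact ⟨y, hs, rfl⟩
    · rintro ⟨y, hy, rfl⟩
      exact ⟨_, hy, castLin_castVec b y⟩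
  rw [latCount, this, Set.ncard_image_of_injective, latCount]
  intro y z hyz
  refine castVec_injective (castLin_injective hb ?_)
  rw [castLin_castVec, castLin_castVec]
  exact congrArg castVec hyz

/-- The lattice points in the direction of a lattice polytope have a basis whose cardinality is
the dimension of the polytope. -/
theorem exists_lattice_basis {d : ℕ} {P : Set (Fin d → ℝ)} (hP : IsLatticePolytope P) :
    ∃ b : Fin (polyDim P) → Fin d → ℤ, LinearIndependent ℤ b ∧
      ∀ x : Fin d → ℤ,
        castVec x ∈ (affineSpan ℝ P).direction ↔ x ∈ Submodule.span ℤ (Set.range b) := by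
  let N : Submodule ℤ (Fin d → ℤ) :=
    { carrier := {x | castVec x ∈ (affineSpan ℝ P).direction}
      add_mem' := fun {x y} hx hy => by
        simp only [Set.mem_ofPred_eq] at hx hy ⊢
        rw [castVec_add]
        exact Submodule.add_mem _ hx hy
      zero_mem' := by
        have : castVec (0 : Fin d → ℤ) = 0 := by
          ext
          simp [castVec]
        simp [this]
      smul_mem' := fun n x hx => by
        simp only [Set.mem_ofPred_eq] at hx ⊢
        rw [castVec_smul]
        exact Submodule.smul_mem _ _ hx }
  obtain ⟨k, ⟨e⟩⟩ := Submodule.nonempty_basis_of_pid (Pi.basisFun ℤ (Fin d)) N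
  let b : Fin k → Fin d → ℤ := fun i => (e i : Fin d → ℤ)
  have hb : LinearIndependent ℤ b := e.linearIndependent.map' N.subtype N.ker_subtype
  have hspan : Submodule.span ℤ (Set.range b) = N := by
    have := congrArg (Submodule.map N.subtype) e.span_eq
    rwa [Submodule.map_span, ← Set.range_comp, Submodule.map_top, N.range_subtype] at this
  have hmem : ∀ x : Fin d → ℤ,
      castVec x ∈ (affineSpan ℝ P).direction ↔ x ∈ Submodule.span ℤ (Set.range b) := by
    intro x
    rw [hspan]
    rfl
  have hk : polyDim P = k := by
    rw [polyDim, ← range_castLin hP hmem, LinearMap.finrank_range_of_inj (castLin_injective hb)]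
    simp
  subst hk
  exact ⟨b, hb, hmem⟩

/-- Lattice point asymptotics of translated dilates of a lattice polytope. -/
theorem tendsto_latCount_of_lattice_basis {d k : ℕ} {P : Set (Fin d → ℝ)}
    (hP : IsLatticePolytope P) (v₀ : Fin d → ℤ) (b : Fin k → Fin d → ℤ)
    (hv₀ : castVec v₀ ∈ P) (hb : LinearIndependent ℤ b)
    (hspan : ∀ x : Fin d → ℤ,
      castVec x ∈ (affineSpan ℝ P).direction ↔ x ∈ Submodule.span ℤ (Set.range b))
    (c : Fin d → ℝ) (t₀ : ℕ) (ht₀ : latCount (c +ᵥ (t₀ : ℝ) • P) ≠ 0) :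
    0 < volume.real {lam : Fin k → ℝ | castVec v₀ + ∑ i, lam i • castVec (b i) ∈ P} ∧
    Tendsto (fun t : ℕ => (latCount (c +ᵥ (t : ℝ) • P) : ℝ) / (t : ℝ) ^ k) atTop
      (𝓝 (volume.real {lam : Fin k → ℝ | castVec v₀ + ∑ i, lam i • castVec (b i) ∈ P})) := by
  set Q : Set (Fin k → ℝ) := {lam | castVec v₀ + ∑ i, lam i • castVec (b i) ∈ P} with hQ
  have hinj := castLin_injective hb
  have hrange := range_castLin hP hspan
  obtain ⟨hPcomp, hPconv⟩ : IsCompact P ∧ Convex ℝ P := by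
    obtain ⟨V, -, rfl⟩ := hP
    exact ⟨(V.finite_toSet.image _).isCompact_convexHull ℝ, convex_convexHull ℝ _⟩
  have hQpre : Q = castLin b ⁻¹' ((fun x => castVec v₀ + x) ⁻¹' P) := by
    ext lam
    simp [hQ, castLin_apply]
  have hQimg : castLin b '' Q = (fun x => castVec v₀ + x) ⁻¹' P := by
    rw [hQpre, Set.image_preimage_eq_inter_range, Set.inter_eq_left]
    intro x hx
    rw [← LinearMap.coe_range, hrange, SetLike.mem_coe]
    have := AffineSubspace.vsub_mem_direction (mem_affineSpan ℝ (Set.mem_preimage.1 hx))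
      (mem_affineSpan ℝ hv₀)
    simpa using this
  have hcomp : IsCompact Q := by
    rw [hQpre]
    refine (LinearMap.isClosedEmbedding_of_injective
      (LinearMap.ker_eq_bot.2 hinj)).isCompact_preimage ?_
    exact (Homeomorph.addLeft (castVec v₀)).isCompact_preimage.2 hPcomp
  have hconv : Convex ℝ Q := by
    rw [hQpre]
    exact (hPconv.translate_preimage_right _).linear_preimage _
  have hne : Q.Nonempty := ⟨0, by simpa [hQ] using hv₀⟩
  have hint : (interior Q).Nonempty := by
    rw [hconv.interior_nonempty_iff_affineSpan_eq_top,
      AffineSubspace.affineSpan_eq_top_iff_vectorSpan_eq_top_of_nonempty ℝ _ _ hne]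
    refine Submodule.map_injective_of_injective hinj ?_
    have h1 := (castLin b).toAffineMap.map_vectorSpan (s := Q)
    simp only [LinearMap.toAffineMap_linear, LinearMap.coe_toAffineMap] at h1
    have h2 : (fun x => castVec v₀ + x) ⁻¹' P = -castVec v₀ +ᵥ P := by
      ext x
      simp [Set.mem_vadd_set_iff_neg_vadd_mem]
    rw [h1, Submodule.map_top, hrange, hQimg, h2, direction_affineSpan, vectorSpan_vadd]
  refine ⟨ENNReal.toReal_pos ?_ hcomp.measure_lt_top.ne, ?_⟩
  · exact (Measure.measure_pos_of_nonempty_interior _ hint).ne'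
  have hPimg : P = castVec v₀ +ᵥ castLin b '' Q := by
    rw [hQimg]
    ext x
    simp [Set.mem_vadd_set_iff_neg_vadd_mem]
  obtain ⟨z, hz⟩ := Set.nonempty_of_ncard_ne_zero ht₀
  simp only [Set.mem_ofPred_eq] at hz
  rw [hPimg] at hz
  obtain ⟨_, ⟨_, ⟨_, ⟨q, hq, rfl⟩, rfl⟩, rfl⟩, hz⟩ := hz
  simp only [vadd_eq_add] at hz
  have hcount (t : ℕ) : latCount (c +ᵥ (t : ℝ) • P) =
      latCount ((-(t₀ : ℝ) • q) +ᵥ (t : ℝ) • Q) := by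
    rw [← latCount_image_castLin hb (fun x hx => (hspan x).1 (hrange ▸ hx)),
      ← latCount_castVec_vadd (z - (t₀ : ℤ) • v₀ + (t : ℤ) • v₀) (castLin b '' _)]
    congr 1
    conv_lhs => rw [hPimg]
    simp only [← Set.image_vadd, ← Set.image_smul, Set.image_image]
    refine Set.image_congr fun x _ => ?_
    simp only [castVec_add, castVec_sub, castVec_smul, ← hz, vadd_eq_add, map_add, map_smul,
      smul_add, Int.cast_natCast, neg_smul, map_neg]
    abel
  simp_rw [hcount]
  exact tendsto_latCount_vadd_smul_div_pow hcomp hconv hint _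

/-- For a lattice polytope `P ⊂ ℝ^d` and any `c ∈ ℝ^d`, the translated
lattice point enumerator `t ↦ #((c + tP) ∩ ℤ^d)` agrees with a polynomial `f ∈ ℚ[x]`;
if it is not identically zero, `f` has degree `dim P` and leading coefficient
`relvol(P)`. -/
theorem translated_lattice_point_enumerator_polynomial
    (d : ℕ) (P : Set (Fin d → ℝ)) (hP : IsLatticePolytope P) (c : Fin d → ℝ) :
    ∃ f : Polynomial ℚ,
      (∀ t : ℕ, 0 < t → (latCount (c +ᵥ (t : ℝ) • P) : ℚ) = f.eval (t : ℚ)) ∧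
      ((∃ t : ℕ, 0 < t ∧ latCount (c +ᵥ (t : ℝ) • P) ≠ 0) →
        f.natDegree = polyDim P ∧ IsRelVolOf P (polyDim P) (f.leadingCoeff : ℝ)) := by
  obtain ⟨f, hf⟩ := exists_polynomial_latCount hP c
  refine ⟨f, fun t _ => hf t, ?_⟩
  rintro ⟨t₀, -, ht₀⟩
  have hmain : ∀ (v₀ : Fin d → ℤ) (b : Fin (polyDim P) → Fin d → ℤ),
      castVec v₀ ∈ P → LinearIndependent ℤ b →
      (∀ x : Fin d → ℤ,
        castVec x ∈ (affineSpan ℝ P).direction ↔ x ∈ Submodule.span ℤ (Set.range b)) →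
      f.natDegree = polyDim P ∧ (f.leadingCoeff : ℝ) =
        volume.real {lam : Fin (polyDim P) → ℝ |
          castVec v₀ + ∑ i, lam i • castVec (b i) ∈ P} := by
    intro v₀ b hv₀ hb hspan
    obtain ⟨hpos, hlim⟩ := tendsto_latCount_of_lattice_basis hP v₀ b hv₀ hb hspan c t₀ ht₀
    have heval (t : ℕ) : (latCount (c +ᵥ (t : ℝ) • P) : ℝ) =
        (f.map (algebraMap ℚ ℝ)).eval (t : ℝ) := by
      have := congrArg (algebraMap ℚ ℝ) (hf t)
      rw [← Polynomial.eval_map_apply, map_natCast, map_natCast] at this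
      exact this
    simp_rw [heval] at hlim
    obtain ⟨h1, h2⟩ := natDegree_eq_and_leadingCoeff_eq_of_tendsto _ _ hpos.ne' hlim
    rw [Polynomial.natDegree_map] at h1
    rw [Polynomial.leadingCoeff_map] at h2
    exact ⟨h1, h2⟩
  refine ⟨?_, fun v₀ b hv₀ hb hspan => (hmain v₀ b hv₀ hb hspan).2⟩
  obtain ⟨b, hb, hspan⟩ := exists_lattice_basis hP
  obtain ⟨v₀, hv₀⟩ : ∃ v₀ : Fin d → ℤ, castVec v₀ ∈ P := by
    obtain ⟨V, ⟨v, hv⟩, rfl⟩ := hP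
    exact ⟨v, subset_convexHull ℝ _ ⟨v, hv, rfl⟩⟩
  exact (hmain v₀ b hv₀ hb hspan).1
end
end
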